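/- arXiv:2404.18487 — 8 statements merged into one kernel-verified Lean document; each statement's English description precedes it below -/
import Mathlib

section
/- Let G = (V, E, A) be a connected graph on vertex set V = {1,...,N} with symmetric nonnegative weight matrix A = (a_{ij}) and edge set E = {(i,j) : a_{ij} > 0}. Let r denote the maximum over all pairs (i,j) of the length of the shortest path from i to j, and let |E^c| be the cardinality of the complement of E in V × V. Then for any real numbers θ_1,...,θ_N, one has (1/(1 + r|E^c|)) · Σ_{i=1}^N Σ_{j=1}^N |θ_i − θ_j|² ≤ Σ_{(i,j)∈E} |θ_i − θ_j|² ≤ Σ_{i=1}^N Σ_{j=1}^N |θ_i − θ_j|². -/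
open Finset

lemma walk_sq_le {V : Type*} (G : SimpleGraph V) (θ : V → ℝ) {u v : V} (p : G.Walk u v) :
    (θ u - θ v) ^ 2 ≤ p.length *
      (p.darts.map (fun d => (θ d.toProd.1 - θ d.toProd.2) ^ 2)).sum := by
  induction p with
  | nil => simp
  | @cons u w v h p ih =>
    simp only [SimpleGraph.Walk.length_cons, SimpleGraph.Walk.darts_cons, List.map_cons,
      List.sum_cons]
    push_cast
    have hs : 0 ≤ (p.darts.map (fun d => (θ d.toProd.1 - θ d.toProd.2) ^ 2)).sum := by
      apply List.sum_nonneg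
      intro x hx
      obtain ⟨d, -, rfl⟩ := List.mem_map.1 hx
      positivity
    generalize (p.darts.map (fun d => (θ d.toProd.1 - θ d.toProd.2) ^ 2)).sum = s at *
    have hn : (0 : ℝ) ≤ p.length := by positivity
    generalize (p.length : ℝ) = n at *
    have e : θ u - θ v = (θ u - θ w) + (θ w - θ v) := by ring
    rw [e]
    generalize θ u - θ w = x at *
    generalize θ w - θ v = y at *
    have h2 : 2 * x * y ≤ s + n * x ^ 2 := by
      refine le_of_abs_le (abs_le_of_sq_le_sq ?_ ?_)
      · have := mul_le_mul_of_nonneg_left ih (sq_nonneg x)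
        nlinarith [sq_nonneg (s - n * x ^ 2)]
      · positivity
    nlinarith

lemma pair_le {N : ℕ} (a : Fin N → Fin N → ℝ) (G : SimpleGraph (Fin N))
    (hadj : ∀ i j, G.Adj i j ↔ i ≠ j ∧ 0 < a i j) (hconn : G.Connected)
    (r : ℕ) (hr : r = Finset.univ.sup (fun p : Fin N × Fin N => G.dist p.1 p.2))
    (θ : Fin N → ℝ) (i j : Fin N) :
    |θ i - θ j| ^ 2 ≤ r *
      ∑ p ∈ Finset.filter (fun p : Fin N × Fin N => 0 < a p.1 p.2) Finset.univ,
          |θ p.1 - θ p.2| ^ 2 := by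
  obtain ⟨p, hp, hl⟩ := hconn.exists_path_of_dist i j
  have hle : p.length ≤ r := by
    rw [hl, hr]
    exact Finset.le_sup (f := fun p : Fin N × Fin N => G.dist p.1 p.2) (Finset.mem_univ (i, j))
  simp only [sq_abs]
  have hnd : (p.darts.map (fun d => d.toProd)).Nodup := by
    apply List.Nodup.map SimpleGraph.Dart.toProd_injective
    exact List.Nodup.of_map _ hp.isTrail.edges_nodup
  have hsum : (p.darts.map (fun d => (θ d.toProd.1 - θ d.toProd.2) ^ 2)).sum ≤
      ∑ p ∈ Finset.filter (fun p : Fin N × Fin N => 0 < a p.1 p.2) Finset.univ,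
          (θ p.1 - θ p.2) ^ 2 := by
    have := List.sum_toFinset (fun q : Fin N × Fin N => (θ q.1 - θ q.2) ^ 2) hnd
    rw [List.map_map] at this
    refine (le_of_eq this.symm).trans ?_
    apply Finset.sum_le_sum_of_subset_of_nonneg
    · intro q hq
      simp only [List.mem_toFinset, List.mem_map] at hq
      obtain ⟨d, -, rfl⟩ := hq
      simpa using ((hadj _ _).1 d.adj).2
    · intros; positivity
  refine (walk_sq_le G θ p).trans ?_
  refine (mul_le_mul_of_nonneg_left hsum (by positivity)).trans ?_
  apply mul_le_mul_of_nonneg_right (by exact_mod_cast hle)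
  exact Finset.sum_nonneg (fun _ _ => by positivity)

/-- equivalence of the full pairwise sum and the sum over edges
for the squared phase differences, on a connected symmetric weighted graph. -/
theorem edge_sum_equivalence_phases
    (N : ℕ) (hN : 0 < N)
    (a : Fin N → Fin N → ℝ)
    (hsym : ∀ i j, a i j = a j i)
    (hnn : ∀ i j, 0 ≤ a i j)
    (G : SimpleGraph (Fin N))
    (hadj : ∀ i j, G.Adj i j ↔ i ≠ j ∧ 0 < a i j)
    (hconn : G.Connected)
    (r : ℕ)
    (hr : r = Finset.univ.sup (fun p : Fin N × Fin N => G.dist p.1 p.2))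
    (Ec : ℕ)
    (hEc : Ec = (Finset.filter
      (fun p : Fin N × Fin N => ¬ 0 < a p.1 p.2) Finset.univ).card)
    (θ : Fin N → ℝ) :
    (1 / (1 + (r : ℝ) * (Ec : ℝ))) * ∑ i, ∑ j, |θ i - θ j| ^ 2
      ≤ ∑ p ∈ Finset.filter (fun p : Fin N × Fin N => 0 < a p.1 p.2) Finset.univ,
          |θ p.1 - θ p.2| ^ 2
    ∧ ∑ p ∈ Finset.filter (fun p : Fin N × Fin N => 0 < a p.1 p.2) Finset.univ,
          |θ p.1 - θ p.2| ^ 2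
      ≤ ∑ i, ∑ j, |θ i - θ j| ^ 2 := by
  rw [← Finset.sum_product' (f := fun i j => |θ i - θ j| ^ 2), Finset.univ_product_univ,
    ← Finset.sum_filter_add_sum_filter_not Finset.univ
      (fun p : Fin N × Fin N => 0 < a p.1 p.2) (fun p => |θ p.1 - θ p.2| ^ 2)]
  have h1 := Finset.sum_le_card_nsmul
    (Finset.filter (fun p : Fin N × Fin N => ¬ 0 < a p.1 p.2) Finset.univ)
    (fun p => |θ p.1 - θ p.2| ^ 2) _
    (fun q _ => pair_le a G hadj hconn r hr θ q.1 q.2)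
  rw [← hEc, nsmul_eq_mul] at h1
  constructor
  · rw [one_div, inv_mul_le_iff₀ (by positivity)]
    linarith
  · have : 0 ≤ ∑ p ∈ Finset.filter (fun p : Fin N × Fin N => ¬ 0 < a p.1 p.2) Finset.univ,
        |θ p.1 - θ p.2| ^ 2 := Finset.sum_nonneg (fun _ _ => by positivity)
    linarith
end

section
/- Let G = (V, E, A) be a connected graph on vertex set V = {1,...,N} with symmetric nonnegative weight matrix A = (a_{ij}) and edge set E = {(i,j) : a_{ij} > 0}. Let r denote the maximum over all pairs (i,j) of the length of the shortest path from i to j, and let |E^c| be the cardinality of the complement of E in V × V. Then for any real numbers ω_1,...,ω_N, one has (1/(1 + r|E^c|)) · Σ_{i=1}^N Σ_{j=1}^N |ω_i − ω_j|² ≤ Σ_{(i,j)∈E} |ω_i − ω_j|² ≤ Σ_{i=1}^N Σ_{j=1}^N |ω_i − ω_j|². -/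
open Finset

lemma aux_step (n x y T : ℝ) (hn : 0 ≤ n) (hT : 0 ≤ T) (h : y ^ 2 ≤ n * T) :
    (x + y) ^ 2 ≤ (n + 1) * (x ^ 2 + T) := by
  have h1 : 2 * (x * y) ≤ n * x ^ 2 + T := by
    apply le_of_abs_le
    apply abs_le_of_sq_le_sq _ (by positivity)
    nlinarith [sq_nonneg (n * x ^ 2 - T), mul_le_mul_of_nonneg_left h (sq_nonneg x)]
  nlinarith

lemma aux_walk {V : Type*} (G : SimpleGraph V) (ω : V → ℝ) {u v : V} (p : G.Walk u v) :
    0 ≤ (p.darts.map (fun d => |ω d.fst - ω d.snd| ^ 2)).sum ∧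
    (ω u - ω v) ^ 2 ≤ p.length * (p.darts.map (fun d => |ω d.fst - ω d.snd| ^ 2)).sum := by
  induction p with
  | nil => simp
  | @cons u w v h p ih =>
    obtain ⟨h0, h1⟩ := ih
    simp only [SimpleGraph.Walk.darts_cons, List.map_cons, List.sum_cons,
      SimpleGraph.Walk.length_cons]
    refine ⟨by positivity, ?_⟩
    have := aux_step _ (ω u - ω w) _ _ (Nat.cast_nonneg p.length) h0 h1
    rw [sq_abs]
    push_cast
    simpa using this

/-- equivalence of the full pairwise sum and the sum over edges
for the squared frequency differences, on a connected symmetric weighted graph. -/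
theorem edge_sum_equivalence_frequencys
    (N : ℕ) (hN : 0 < N)
    (a : Fin N → Fin N → ℝ)
    (hsym : ∀ i j, a i j = a j i)
    (hnn : ∀ i j, 0 ≤ a i j)
    (G : SimpleGraph (Fin N))
    (hadj : ∀ i j, G.Adj i j ↔ i ≠ j ∧ 0 < a i j)
    (hconn : G.Connected)
    (r : ℕ)
    (hr : r = Finset.univ.sup (fun p : Fin N × Fin N => G.dist p.1 p.2))
    (Ec : ℕ)
    (hEc : Ec = (Finset.filter
      (fun p : Fin N × Fin N => ¬ 0 < a p.1 p.2) Finset.univ).card)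
    (ω : Fin N → ℝ) :
    (1 / (1 + (r : ℝ) * (Ec : ℝ))) * ∑ i, ∑ j, |ω i - ω j| ^ 2
      ≤ ∑ p ∈ Finset.filter (fun p : Fin N × Fin N => 0 < a p.1 p.2) Finset.univ,
          |ω p.1 - ω p.2| ^ 2
    ∧ ∑ p ∈ Finset.filter (fun p : Fin N × Fin N => 0 < a p.1 p.2) Finset.univ,
          |ω p.1 - ω p.2| ^ 2
      ≤ ∑ i, ∑ j, |ω i - ω j| ^ 2 := by
  set S := ∑ p ∈ Finset.filter (fun p : Fin N × Fin N => 0 < a p.1 p.2) Finset.univ,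
          |ω p.1 - ω p.2| ^ 2 with hS
  have hS0 : 0 ≤ S := Finset.sum_nonneg (fun _ _ => by positivity)
  have key : ∀ i j, |ω i - ω j| ^ 2 ≤ r * S := by
    intro i j
    obtain ⟨p, hp, hl⟩ := hconn.exists_path_of_dist i j
    obtain ⟨h0, h1⟩ := aux_walk G ω p
    have hnd : (p.darts.map (fun d => d.toProd)).Nodup :=
      (SimpleGraph.Walk.darts_nodup_of_support_nodup hp.support_nodup).map
        SimpleGraph.Dart.toProd_injective
    have h2 : (p.darts.map (fun d => |ω d.fst - ω d.snd| ^ 2)).sum ≤ S := by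
      have h3 := List.sum_toFinset (fun q : Fin N × Fin N => |ω q.1 - ω q.2| ^ 2) hnd
      rw [List.map_map] at h3
      change _ = (p.darts.map (fun d => |ω d.fst - ω d.snd| ^ 2)).sum at h3
      rw [← h3]
      apply Finset.sum_le_sum_of_subset_of_nonneg
      · intro q hq
        simp only [List.mem_toFinset, List.mem_map] at hq
        obtain ⟨d, -, rfl⟩ := hq
        simpa using ((hadj _ _).1 d.adj).2
      · intros; positivity
    have h4 : p.length ≤ r := by
      rw [hl, hr]
      exact Finset.le_sup (f := fun p : Fin N × Fin N => G.dist p.1 p.2) (Finset.mem_univ (i, j))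
    rw [sq_abs]
    refine h1.trans ?_
    have h5 : (p.length : ℝ) ≤ r := by exact_mod_cast h4
    gcongr
  have hsplit : ∑ i, ∑ j, |ω i - ω j| ^ 2 = S +
      ∑ p ∈ Finset.filter (fun p : Fin N × Fin N => ¬ 0 < a p.1 p.2) Finset.univ,
          |ω p.1 - ω p.2| ^ 2 := by
    rw [hS, Finset.sum_filter_add_sum_filter_not, Fintype.sum_prod_type]
  have hc : ∑ p ∈ Finset.filter (fun p : Fin N × Fin N => ¬ 0 < a p.1 p.2) Finset.univ,
          |ω p.1 - ω p.2| ^ 2 ≤ Ec * (r * S) := by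
    rw [hEc, ← nsmul_eq_mul]
    exact Finset.sum_le_card_nsmul _ _ _ (fun p _ => key p.1 p.2)
  have hc0 : 0 ≤ ∑ p ∈ Finset.filter (fun p : Fin N × Fin N => ¬ 0 < a p.1 p.2) Finset.univ,
          |ω p.1 - ω p.2| ^ 2 := Finset.sum_nonneg (fun _ _ => by positivity)
  rw [hsplit]
  refine ⟨?_, by linarith⟩
  rw [one_div, inv_mul_le_iff₀ (by positivity)]
  nlinarith
end

section
/- Let G = (V, E, A) be a symmetric connected graph on V = {1,...,N} with a_l = min_{(i,j)∈E} a_{ij}, a_u = max_{(i,j)∈E} a_{ij}, r the maximal graph distance, and |E^c| the cardinality of the complement of E in V×V. Let K > 0, α ∈ (0, π/2), D₀ ∈ (0, π), and let θ_1,...,θ_N be real numbers with max_{1≤i,j≤N} |θ_i − θ_j| < D₀. Then (K/N) sin α · Σ_{i=1}^N Σ_{j=1}^N Σ_{l=1}^N [a_{il} cos(θ_l − θ_i) − a_{jl} cos(θ_l − θ_j)] · 2(θ_i − θ_j) ≤ (12 N² K a_u² sin²α (1 + |E^c| r) D₀)/(a_l cos α sin D₀) + (1/3) K a_l cos α ·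 (sin D₀ / D₀) · (1/(1 + r|E^c|)) · Σ_{i=1}^N Σ_{j=1}^N (θ_i − θ_j)². -/
open Finset Real

/-- estimate of the frustration (cosine) term against the phase differences. -/
theorem frustration_phase_estimate
    (N : ℕ) (hN : 0 < N)
    (a : Fin N → Fin N → ℝ)
    (hsym : ∀ i j, a i j = a j i)
    (hnn : ∀ i j, 0 ≤ a i j)
    (G : SimpleGraph (Fin N))
    (hadj : ∀ i j, G.Adj i j ↔ i ≠ j ∧ 0 < a i j)
    (hconn : G.Connected)
    (hEne : (Finset.filter (fun p : Fin N × Fin N => 0 < a p.1 p.2) Finset.univ).Nonempty)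
    (r : ℕ)
    (hr : r = Finset.univ.sup (fun p : Fin N × Fin N => G.dist p.1 p.2))
    (Ec : ℕ)
    (hEc : Ec = (Finset.filter
      (fun p : Fin N × Fin N => ¬ 0 < a p.1 p.2) Finset.univ).card)
    (al : ℝ)
    (hal : al = (Finset.filter (fun p : Fin N × Fin N => 0 < a p.1 p.2) Finset.univ).inf' hEne (fun p => a p.1 p.2))
    (au : ℝ)
    (hau : au = (Finset.filter (fun p : Fin N × Fin N => 0 < a p.1 p.2) Finset.univ).sup' hEne (fun p => a p.1 p.2))
    (K α D0 : ℝ) (hK : 0 < K) (hα : 0 < α ∧ α < Real.pi / 2)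
    (hD0 : 0 < D0 ∧ D0 < Real.pi)
    (θ : Fin N → ℝ)
    (hdiam : ∀ i j, |θ i - θ j| < D0) :
    (K / (N : ℝ)) * Real.sin α *
        ∑ i, ∑ j, ∑ l, (a i l * Real.cos (θ l - θ i) - a j l * Real.cos (θ l - θ j))
          * (2 * (θ i - θ j))
      ≤ 12 * (N : ℝ) ^ 2 * K * au ^ 2 * Real.sin α ^ 2 * (1 + (Ec : ℝ) * (r : ℝ)) * D0
          / (al * Real.cos α * Real.sin D0)
        + (1 / 3) * K * al * Real.cos α * (Real.sin D0 / D0)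
          * (1 / (1 + (r : ℝ) * (Ec : ℝ))) * ∑ i, ∑ j, (θ i - θ j) ^ 2 := by
  obtain ⟨hα0, hα1⟩ := hα
  obtain ⟨hD, hDpi⟩ := hD0
  have hs : 0 < Real.sin α := Real.sin_pos_of_pos_of_lt_pi hα0 (by linarith [Real.pi_pos])
  have hc : 0 < Real.cos α := Real.cos_pos_of_mem_Ioo ⟨by linarith [Real.pi_pos], hα1⟩
  have hsD : 0 < Real.sin D0 := Real.sin_pos_of_pos_of_lt_pi hD hDpi
  have hNr : (0 : ℝ) < N := by exact_mod_cast hN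
  have hal0 : 0 < al := by
    rw [hal, Finset.lt_inf'_iff]
    intro p hp
    exact (Finset.mem_filter.mp hp).2
  have hle : ∀ i j, 0 < a i j → a i j ≤ au := by
    intro i j hij
    rw [hau]
    exact Finset.le_sup' (fun p : Fin N × Fin N => a p.1 p.2)
      (Finset.mem_filter.mpr ⟨Finset.mem_univ (i, j), hij⟩)
  have hau0 : 0 < au := by
    obtain ⟨p, hp⟩ := hEne
    have h := (Finset.mem_filter.mp hp).2
    exact lt_of_lt_of_le h (hle _ _ h)
  have hle' : ∀ i j, a i j ≤ au := by
    intro i j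
    rcases (hnn i j).lt_or_eq with h | h
    · exact hle i j h
    · rw [← h]; exact hau0.le
  have hac : ∀ i l x, |a i l * Real.cos x| ≤ au := by
    intro i l x
    rw [abs_mul, abs_of_nonneg (hnn i l)]
    have h1 := Real.abs_cos_le_one x
    nlinarith [hnn i l, hle' i l, abs_nonneg (Real.cos x)]
  have hM : (0 : ℝ) < 1 + (r : ℝ) * (Ec : ℝ) := by positivity
  set M : ℝ := 1 + (r : ℝ) * (Ec : ℝ) with hMdef
  have hM' : 1 + (Ec : ℝ) * (r : ℝ) = M := by rw [hMdef]; ring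
  rw [hM']
  set B : ℝ := al * Real.cos α * Real.sin D0 / (D0 * M) with hB
  have hB0 : 0 < B := by positivity
  have hterm : ∀ i j, (K / (N : ℝ)) * Real.sin α *
      ∑ l, (a i l * Real.cos (θ l - θ i) - a j l * Real.cos (θ l - θ j)) * (2 * (θ i - θ j))
      ≤ 12 * K * au ^ 2 * Real.sin α ^ 2 / B + K * B / 3 * (θ i - θ j) ^ 2 := by
    intro i j
    have h1 : ∑ l, (a i l * Real.cos (θ l - θ i) - a j l * Real.cos (θ l - θ j))
        * (2 * (θ i - θ j)) ≤ ∑ _l : Fin N, 4 * au * |θ i - θ j| := by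
      apply Finset.sum_le_sum
      intro l _
      refine (le_abs_self _).trans ?_
      rw [abs_mul, abs_mul, abs_two]
      have h2 : |a i l * Real.cos (θ l - θ i) - a j l * Real.cos (θ l - θ j)| ≤ 2 * au := by
        refine (abs_sub _ _).trans ?_
        linarith [hac i l (θ l - θ i), hac j l (θ l - θ j)]
      nlinarith [abs_nonneg (θ i - θ j)]
    rw [Finset.sum_const, Finset.card_univ, Fintype.card_fin, nsmul_eq_mul] at h1
    have h3 := mul_le_mul_of_nonneg_left h1
      (by positivity : 0 ≤ (K / (N : ℝ)) * Real.sin α)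
    refine h3.trans ?_
    rw [← sq_abs (θ i - θ j)]
    generalize |θ i - θ j| = x
    have h4 : 12 * K * au ^ 2 * Real.sin α ^ 2 / B + K * B / 3 * x ^ 2
        - (K / (N : ℝ)) * Real.sin α * (N * (4 * au * x))
        = K / (3 * B) * (6 * au * Real.sin α - B * x) ^ 2 := by
      clear_value B
      field_simp
      ring
    have h5 : 0 ≤ K / (3 * B) * (6 * au * Real.sin α - B * x) ^ 2 := by positivity
    linarith
  have hsum : ∑ i, ∑ j, ((K / (N : ℝ)) * Real.sin α *
      ∑ l, (a i l * Real.cos (θ l - θ i) - a j l * Real.cos (θ l - θ j)) * (2 * (θ i - θ j)))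
      ≤ ∑ i, ∑ j, (12 * K * au ^ 2 * Real.sin α ^ 2 / B + K * B / 3 * (θ i - θ j) ^ 2) :=
    Finset.sum_le_sum fun i _ => Finset.sum_le_sum fun j _ => hterm i j
  simp only [← Finset.mul_sum, Finset.sum_add_distrib, Finset.sum_const, Finset.card_univ,
    Fintype.card_fin, nsmul_eq_mul] at hsum
  refine hsum.trans (le_of_eq ?_)
  congr 1
  · rw [hB]
    clear_value M
    field_simp
  · congr 1
    rw [hB]
    clear_value M
    field_simp
end

section
/- Let G = (V, E, A) be a symmetric connected graph on V = {1,...,N} with a_u = max_{(i,j)∈E} a_{ij}. Let m > 0, K > 0, α ∈ (0, π/2), and let θ_1,...,θ_N and ω_1,...,ω_N be real numbers. Then (2mK/N) cos α · Σ_{i=1}^N Σ_{j=1}^N Σ_{l=1}^N [a_{il} sin(θ_l − θ_i) − a_{jl} sin(θ_l − θ_j)] · 2(ω_i − ω_j) ≤ 12 m K² a_u² cos²α · Σ_{i=1}^N Σ_{j=1}^N (θ_i − θ_j)² + (m/3) Σ_{i=1}^N Σ_{j=1}^N (ω_i − ω_j)². -/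
open Finset Real

theorem antisymm_sum_identity (N : ℕ) (s : Fin N → Fin N → ℝ) (w : Fin N → ℝ)
    (h : ∀ i l, s l i = - s i l) :
    ∑ i, ∑ j, ∑ l, (s i l - s j l) * (2 * (w i - w j))
      = (2 * (N : ℝ)) * ∑ i, ∑ l, s i l * (w i - w l) := by
  have h0 : ∑ i, ∑ l, s i l = 0 := by
    have h1 : ∑ i, ∑ l, s i l = - ∑ i, ∑ l, s i l := by
      conv_lhs => rw [Finset.sum_comm]
      simp only [← Finset.sum_neg_distrib]
      exact Finset.sum_congr rfl fun i _ => Finset.sum_congr rfl fun l _ => h i l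
    linarith
  have h2 : ∑ i, ∑ l, s i l * w l = - ∑ i, ∑ l, s i l * w i := by
    rw [Finset.sum_comm]
    simp only [← Finset.sum_neg_distrib]
    exact Finset.sum_congr rfl fun i _ => Finset.sum_congr rfl fun l _ => by rw [h i l]; ring
  have h3 : ∀ i j, ∑ l, (s i l - s j l) * (2 * (w i - w j))
      = 2 * ((∑ l, s i l) * w i) - 2 * ((∑ l, s i l) * w j) - 2 * (w i * ∑ l, s j l)
        + 2 * ((∑ l, s j l) * w j) := by
    intro i j
    rw [← Finset.sum_mul, Finset.sum_sub_distrib]; ring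
  have h4 : ∑ i, ∑ l, s i l * (w i - w l) = 2 * ∑ i, (∑ l, s i l) * w i := by
    simp only [mul_sub, Finset.sum_sub_distrib, h2, Finset.sum_mul]; ring
  rw [h4]
  simp only [h3, Finset.sum_add_distrib, Finset.sum_sub_distrib, ← Finset.mul_sum,
    ← Finset.sum_mul, h0, Finset.sum_const, Finset.card_univ, Fintype.card_fin, nsmul_eq_mul]
  have h5 : ∑ x, (∑ l, s x l) * (N : ℝ) * w x = (N : ℝ) * ∑ x, (∑ l, s x l) * w x := by
    rw [Finset.mul_sum]
    exact Finset.sum_congr rfl fun x _ => by ring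
  ring_nf
  rw [h5]
  ring

/-- estimate of the sine coupling term against the frequency differences. -/
theorem sine_coupling_frequency_estimate
    (N : ℕ) (hN : 0 < N)
    (a : Fin N → Fin N → ℝ)
    (hsym : ∀ i j, a i j = a j i)
    (hnn : ∀ i j, 0 ≤ a i j)
    (G : SimpleGraph (Fin N))
    (hadj : ∀ i j, G.Adj i j ↔ i ≠ j ∧ 0 < a i j)
    (hconn : G.Connected)
    (hEne : (Finset.filter (fun p : Fin N × Fin N => 0 < a p.1 p.2) Finset.univ).Nonempty)
    (r : ℕ)
    (hr : r = Finset.univ.sup (fun p : Fin N × Fin N => G.dist p.1 p.2))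
    (Ec : ℕ)
    (hEc : Ec = (Finset.filter
      (fun p : Fin N × Fin N => ¬ 0 < a p.1 p.2) Finset.univ).card)
    (au : ℝ)
    (hau : au = (Finset.filter (fun p : Fin N × Fin N => 0 < a p.1 p.2) Finset.univ).sup' hEne (fun p => a p.1 p.2))
    (m K α : ℝ) (hm : 0 < m) (hK : 0 < K) (hα : 0 < α ∧ α < Real.pi / 2)
    (θ ω : Fin N → ℝ) :
    (2 * m * K / (N : ℝ)) * Real.cos α *
        ∑ i, ∑ j, ∑ l, (a i l * Real.sin (θ l - θ i) - a j l * Real.sin (θ l - θ j))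
          * (2 * (ω i - ω j))
      ≤ 12 * m * K ^ 2 * au ^ 2 * Real.cos α ^ 2 * ∑ i, ∑ j, (θ i - θ j) ^ 2
        + (m / 3) * ∑ i, ∑ j, (ω i - ω j) ^ 2 := by
  have hle : ∀ i j, a i j ≤ au := by
    intro i j
    have hpos : ∀ i j, 0 < a i j → a i j ≤ au := by
      intro i j h
      rw [hau]
      exact Finset.le_sup' (fun p : Fin N × Fin N => a p.1 p.2) (b := (i, j)) (by simpa using h)
    rcases (hnn i j).lt_or_eq with h | h
    · exact hpos i j h
    · obtain ⟨p, hp⟩ := hEne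
      have hp' : 0 < a p.1 p.2 := by simpa using hp
      rw [← h]
      exact hp'.le.trans (hpos _ _ hp')
  have hN' : (N : ℝ) ≠ 0 := by exact_mod_cast hN.ne'
  rw [antisymm_sum_identity N (fun i l => a i l * Real.sin (θ l - θ i)) ω (by
    intro i l
    rw [hsym l i, ← neg_sub (θ l) (θ i), Real.sin_neg]; ring)]
  have e : ∀ S : ℝ, 2 * m * K / (N : ℝ) * Real.cos α * (2 * (N : ℝ) * S)
      = 4 * m * K * Real.cos α * S := by
    intro S; field_simp; ring
  rw [e]
  simp only [Finset.mul_sum, ← Finset.sum_add_distrib]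
  refine Finset.sum_le_sum fun i _ => Finset.sum_le_sum fun l _ => ?_
  have hb : (a i l * Real.sin (θ l - θ i)) ^ 2 ≤ au ^ 2 * (θ i - θ l) ^ 2 := by
    rw [mul_pow]
    refine mul_le_mul (pow_le_pow_left₀ (hnn i l) (hle i l) 2) ?_ (sq_nonneg _) (sq_nonneg _)
    rw [← neg_sub (θ l) (θ i), neg_sq]
    exact sq_le_sq.mpr Real.abs_sin_le_abs
  generalize a i l * Real.sin (θ l - θ i) = x at hb ⊢
  have h1 : 12 * m * K ^ 2 * Real.cos α ^ 2 * x ^ 2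
      ≤ 12 * m * K ^ 2 * Real.cos α ^ 2 * (au ^ 2 * (θ i - θ l) ^ 2) :=
    mul_le_mul_of_nonneg_left hb (by positivity)
  have h2 : 0 ≤ m / 3 * (6 * K * Real.cos α * x - (ω i - ω l)) ^ 2 := by positivity
  linarith
end

section
/- Let G = (V, E, A) be a symmetric connected graph on V = {1,...,N} with a_l = min_{(i,j)∈E} a_{ij}, a_u = max_{(i,j)∈E} a_{ij}, r the maximal graph distance, and |E^c| the cardinality of the complement of E in V×V. Let θ : [0,∞) → ℝ^N be a twice continuously differentiable solution of the second-order Kuramoto model m θ_i'' + θ_i' = Ω_i + (K/N) Σ_{l=1}^N a_{il} sin(θ_l − θ_i + α) with ω_i = θ_i', and define E₁(t) = 2m Σ_{i,j=1}^N (θ_i(t) − θ_j(t))(ω_i(t) − ω_j(t)) + (1 − m√K) Σ_{i,j=1}^N (θ_i(t) − θ_j(t))² + 2m² Σ_{i,j=1}^N (ω_i(t) − ω_j(t))², D_Ω = Σ_{i,j=1}^N |Ω_i − Ω_j|², and C₁ = [3(1+|E^c|r)D₀/(K^{3/2} a_l cos α sin D₀) + 12 m/K^{1/2}] D_Ω +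 12 N² K^{1/2} a_u² sin²α [(1+|E^c|r)D₀/(a_l cos α sin D₀) + 4mK]. Assume E₁(0) < D₀²/8 with D₀ ∈ (0,π); √K > ((1+r|E^c|)/(a_l cos α)) · D₀/sin D₀; m√K < 1/8; mK < (a_l/(a_u²(1+r|E^c|) cos α)) · sin D₀/(36 D₀); and C₁ < D₀²/16. Then for all t ∈ [0,∞), E₁'(t) ≤ √K C₁ − √K E₁(t). -/
open Finset Real

/-- bilinear form of pairwise differences -/
noncomputable def bil {N : ℕ} (f g : Fin N → ℝ) : ℝ := ∑ i, ∑ j, (f i - f j) * (g i - g j)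

lemma bil_eq {N : ℕ} (f g : Fin N → ℝ) :
    bil f g = 2 * N * ∑ i, f i * g i - 2 * (∑ i, f i) * ∑ i, g i := by
  unfold bil
  have : ∀ i j : Fin N, (f i - f j) * (g i - g j)
      = f i * g i + f j * g j - f i * g j - f j * g i := by intros; ring
  simp only [this, Finset.sum_sub_distrib, Finset.sum_add_distrib, ← Finset.mul_sum,
    ← Finset.sum_mul, Finset.sum_const, Finset.card_univ, Fintype.card_fin, nsmul_eq_mul]
  have h : ∑ i, f i * (N : ℝ) * g i = N * ∑ i, f i * g i := by
    rw [Finset.mul_sum]; exact Finset.sum_congr rfl fun i _ => by ring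
  ring_nf
  rw [h]
  ring

lemma bil_add {N : ℕ} (f g h : Fin N → ℝ) :
    bil f (fun i => g i + h i) = bil f g + bil f h := by
  simp only [bil_eq, mul_add, Finset.sum_add_distrib]; ring

lemma bil_self_nonneg {N : ℕ} (f : Fin N → ℝ) : 0 ≤ bil f f :=
  Finset.sum_nonneg fun i _ => Finset.sum_nonneg fun j _ => mul_self_nonneg _

lemma bil_young {N : ℕ} (f g : Fin N → ℝ) (e : ℝ) (he : 0 < e) :
    2 * bil f g ≤ e * bil f f + 1 / e * bil g g := by
  unfold bil
  simp only [Finset.mul_sum, ← Finset.sum_add_distrib]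
  refine Finset.sum_le_sum fun i _ => Finset.sum_le_sum fun j _ => ?_
  generalize f i - f j = a
  generalize g i - g j = b
  have : e * (a * a) + 1 / e * (b * b) - 2 * (a * b) = 1 / e * (e * a - b) ^ 2 := by
    field_simp; ring
  have h2 : 0 ≤ 1 / e * (e * a - b) ^ 2 := by positivity
  linarith

lemma bil_self_le {N : ℕ} (f : Fin N → ℝ) : bil f f ≤ 2 * N * ∑ i, f i ^ 2 := by
  rw [bil_eq]
  have : 0 ≤ (∑ i, f i) * (∑ i, f i) := mul_self_nonneg _
  simp only [sq]
  linarith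

lemma pair_le_bil {N : ℕ} (f : Fin N → ℝ) (i j : Fin N) : (f i - f j) ^ 2 ≤ bil f f := by
  unfold bil
  calc (f i - f j) ^ 2 = (f i - f j) * (f i - f j) := sq _
    _ ≤ ∑ j, (f i - f j) * (f i - f j) :=
      Finset.single_le_sum (f := fun j => (f i - f j) * (f i - f j))
        (fun j _ => mul_self_nonneg _) (Finset.mem_univ j)
    _ ≤ _ := Finset.single_le_sum (f := fun i => ∑ j, (f i - f j) * (f i - f j))
        (fun i _ => Finset.sum_nonneg fun j _ => mul_self_nonneg _) (Finset.mem_univ i)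

lemma bil_antisymm {N : ℕ} (hN : 0 < N) (x : Fin N → ℝ) (b : Fin N → Fin N → ℝ)
    (hb : ∀ i j, b i j = - b j i) (c : ℝ) :
    bil x (fun i => c / N * ∑ l, b i l) = c * ∑ i, ∑ l, (x i - x l) * b i l := by
  have hN' : (N : ℝ) ≠ 0 := by positivity
  have h0 : ∑ i, ∑ l, b i l = 0 := by
    have h1 : ∑ i, ∑ l, b i l = ∑ i, ∑ l, b l i := Finset.sum_comm
    have h2 : ∑ i, ∑ l, b i l = - ∑ i, ∑ l, b l i := by
      simp only [← Finset.sum_neg_distrib]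
      exact Finset.sum_congr rfl fun i _ => Finset.sum_congr rfl fun j _ => hb i j
    linarith
  have h3 : ∑ i, ∑ l, x l * b i l = - ∑ i, ∑ l, x i * b i l := by
    rw [Finset.sum_comm]
    simp only [← Finset.sum_neg_distrib]
    refine Finset.sum_congr rfl fun i _ => Finset.sum_congr rfl fun j _ => ?_
    rw [hb j i]; ring
  rw [bil_eq, ← Finset.mul_sum, h0]
  have h4 : ∑ i, x i * (c / N * ∑ l, b i l) = c / N * ∑ i, ∑ l, x i * b i l := by
    simp only [Finset.mul_sum]
    refine Finset.sum_congr rfl fun i _ => Finset.sum_congr rfl fun j _ => ?_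
    ring
  simp only [sub_mul, Finset.sum_sub_distrib]
  rw [h4, h3]
  field_simp
  ring

lemma walk_bound {V : Type*} (G : SimpleGraph V) (x : V → ℝ) {u v : V} (p : G.Walk u v) :
    0 ≤ (p.darts.map (fun d => (x d.fst - x d.snd) ^ 2)).sum ∧
    (x u - x v) ^ 2 ≤ p.length * (p.darts.map (fun d => (x d.fst - x d.snd) ^ 2)).sum := by
  induction p with
  | nil => simp
  | @cons u v w h p ih =>
    obtain ⟨h0, h1⟩ := ih
    simp only [SimpleGraph.Walk.darts_cons, List.map_cons, List.sum_cons,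
      SimpleGraph.Walk.length_cons, Nat.cast_add, Nat.cast_one]
    generalize (p.darts.map (fun d => (x d.fst - x d.snd) ^ 2)).sum = Q at *
    refine ⟨by positivity, ?_⟩
    have e : x u - x w = (x u - x v) + (x v - x w) := by ring
    rw [e]
    generalize x u - x v = a at *
    generalize x v - x w = b at *
    rcases Nat.eq_zero_or_pos p.length with hz | hz
    · rw [hz] at h1 ⊢
      have : b = 0 := by
        have : b ^ 2 ≤ 0 := by simpa using h1
        exact pow_eq_zero_iff (two_ne_zero) |>.1 (le_antisymm this (sq_nonneg _))
      subst this
      simp; nlinarith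
    · have hn : (0 : ℝ) < p.length := by exact_mod_cast hz
      generalize (p.length : ℝ) = n at *
      have h2 : 2 * a * b ≤ n * a ^ 2 + Q := by
        have : n * (2 * a * b) ≤ n * (n * a ^ 2 + Q) := by nlinarith [sq_nonneg (n * a - b)]
        exact le_of_mul_le_mul_left this hn
      nlinarith

lemma pair_bound {N : ℕ} (a : Fin N → Fin N → ℝ) (G : SimpleGraph (Fin N))
    (hadj : ∀ i j, G.Adj i j ↔ i ≠ j ∧ 0 < a i j) (hconn : G.Connected) (x : Fin N → ℝ)
    (i j : Fin N) :
    (x i - x j) ^ 2 ≤ G.dist i j *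
      ∑ p ∈ Finset.filter (fun p : Fin N × Fin N => 0 < a p.1 p.2) Finset.univ,
        (x p.1 - x p.2) ^ 2 := by
  classical
  obtain ⟨p, hp, hl⟩ := hconn.exists_path_of_dist i j
  obtain ⟨-, h1⟩ := walk_bound G x p
  rw [hl] at h1
  refine h1.trans (mul_le_mul_of_nonneg_left ?_ (Nat.cast_nonneg _))
  have e : (p.darts.map (fun d => (x d.fst - x d.snd) ^ 2))
      = ((p.darts.map (fun d => d.toProd)).map
        (fun q : Fin N × Fin N => (x q.1 - x q.2) ^ 2)) := by
    rw [List.map_map]; rfl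
  have hnd : (p.darts.map (fun d => d.toProd)).Nodup := by
    refine List.Nodup.map ?_ (SimpleGraph.Walk.darts_nodup_of_support_nodup hp.support_nodup)
    exact SimpleGraph.Dart.toProd_injective
  rw [e, ← List.sum_toFinset _ hnd]
  refine Finset.sum_le_sum_of_subset_of_nonneg ?_ (fun _ _ _ => sq_nonneg _)
  intro q hq
  simp only [List.mem_toFinset, List.mem_map] at hq
  obtain ⟨d, -, rfl⟩ := hq
  simp only [Finset.mem_filter, Finset.mem_univ, true_and]
  exact ((hadj _ _).1 d.adj).2

lemma bil_le_edges {N : ℕ} (a : Fin N → Fin N → ℝ) (G : SimpleGraph (Fin N))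
    (hadj : ∀ i j, G.Adj i j ↔ i ≠ j ∧ 0 < a i j) (hconn : G.Connected) (x : Fin N → ℝ)
    (r : ℕ) (hr : r = Finset.univ.sup (fun p : Fin N × Fin N => G.dist p.1 p.2))
    (Ec : ℕ)
    (hEc : Ec = (Finset.filter
      (fun p : Fin N × Fin N => ¬ 0 < a p.1 p.2) Finset.univ).card) :
    bil x x ≤ (1 + (r : ℝ) * Ec) *
      ∑ p ∈ Finset.filter (fun p : Fin N × Fin N => 0 < a p.1 p.2) Finset.univ,
        (x p.1 - x p.2) ^ 2 := by
  have e : bil x x = ∑ p : Fin N × Fin N, (x p.1 - x p.2) ^ 2 := by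
    unfold bil
    rw [Fintype.sum_prod_type]
    simp only [sq]
  rw [e, ← Finset.sum_filter_add_sum_filter_not Finset.univ
    (fun p : Fin N × Fin N => 0 < a p.1 p.2)]
  set Q := ∑ p ∈ Finset.filter (fun p : Fin N × Fin N => 0 < a p.1 p.2) Finset.univ,
        (x p.1 - x p.2) ^ 2 with hQ
  have hQ0 : 0 ≤ Q := Finset.sum_nonneg fun _ _ => sq_nonneg _
  have h : ∑ p ∈ Finset.filter (fun p : Fin N × Fin N => ¬ 0 < a p.1 p.2) Finset.univ,
        (x p.1 - x p.2) ^ 2 ≤ Ec • (r * Q) := by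
    rw [hEc]
    refine Finset.sum_le_card_nsmul _ _ _ ?_
    intro p _
    refine (pair_bound a G hadj hconn x p.1 p.2).trans ?_
    refine mul_le_mul_of_nonneg_right ?_ hQ0
    rw [hr]
    exact_mod_cast Finset.le_sup (f := fun p : Fin N × Fin N => G.dist p.1 p.2)
      (Finset.mem_univ p)
  rw [nsmul_eq_mul] at h
  linarith

lemma mul_sin_bound (D0 y : ℝ) (h0 : 0 < D0) (h1 : D0 < Real.pi) (hy : |y| ≤ D0) :
    Real.sin D0 / D0 * y ^ 2 ≤ y * Real.sin y := by
  have key : ∀ z, 0 ≤ z → z ≤ D0 → Real.sin D0 / D0 * z ^ 2 ≤ z * Real.sin z := by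
    intro z hz hzD
    have hc := strictConcaveOn_sin_Icc.concaveOn
    have hz1 : 0 ≤ 1 - z / D0 := by rw [sub_nonneg, div_le_one h0]; exact hzD
    have hz2 : 0 ≤ z / D0 := by positivity
    have hm0 : (0 : ℝ) ∈ Set.Icc 0 Real.pi := ⟨le_rfl, Real.pi_pos.le⟩
    have hm1 : D0 ∈ Set.Icc 0 Real.pi := ⟨h0.le, h1.le⟩
    have := hc.2 hm0 hm1 hz1 hz2 (by ring)
    simp only [smul_eq_mul, Real.sin_zero, mul_zero, zero_add] at this
    rw [div_mul_cancel₀ _ h0.ne'] at this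
    have h2 := mul_le_mul_of_nonneg_left this hz
    calc _ = z * (z / D0 * Real.sin D0) := by ring
      _ ≤ _ := h2
  rcases le_total 0 y with h | h
  · rw [abs_of_nonneg h] at hy; exact key y h hy
  · rw [abs_of_nonpos h] at hy
    have := key (-y) (by linarith) hy
    rw [Real.sin_neg] at this
    linarith

lemma core_ineq
    (N : ℕ) (hN : 0 < N)
    (a : Fin N → Fin N → ℝ)
    (hsym : ∀ i j, a i j = a j i)
    (hnn : ∀ i j, 0 ≤ a i j)
    (G : SimpleGraph (Fin N))
    (hadj : ∀ i j, G.Adj i j ↔ i ≠ j ∧ 0 < a i j)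
    (hconn : G.Connected)
    (r : ℕ)
    (hr : r = Finset.univ.sup (fun p : Fin N × Fin N => G.dist p.1 p.2))
    (Ec : ℕ)
    (hEc : Ec = (Finset.filter
      (fun p : Fin N × Fin N => ¬ 0 < a p.1 p.2) Finset.univ).card)
    (al au : ℝ) (hal0 : 0 < al) (hal : ∀ i j, 0 < a i j → al ≤ a i j)
    (hau0 : 0 < au) (hau : ∀ i j, a i j ≤ au)
    (m K α D0 s : ℝ) (hm : 0 < m) (hK : 0 < K) (hα : 0 < α ∧ α < Real.pi / 2)
    (hD0 : 0 < D0 ∧ D0 < Real.pi) (hs0 : 0 < s) (hs : s * s = K)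
    (Ω x w : Fin N → ℝ) (hx : ∀ i j, |x i - x j| ≤ D0)
    (C1 : ℝ)
    (hC1 : C1
      = (3 * (1 + (Ec : ℝ) * (r : ℝ)) * D0 / (K * s * al * Real.cos α * Real.sin D0)
          + 12 * m / s) * bil Ω Ω
        + 12 * (N : ℝ) ^ 2 * s * au ^ 2 * Real.sin α ^ 2
          * ((1 + (Ec : ℝ) * (r : ℝ)) * D0 / (al * Real.cos α * Real.sin D0) + 4 * m * K))
    (hKbig : s > ((1 + (r : ℝ) * (Ec : ℝ)) / (al * Real.cos α)) * (D0 / Real.sin D0))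
    (hmK1 : m * s < 1 / 8)
    (hmK2 : m * K
      < (al / (au ^ 2 * (1 + (r : ℝ) * (Ec : ℝ)) * Real.cos α)) * (Real.sin D0 / (36 * D0)))
    (F : Fin N → ℝ)
    (hF : ∀ i, F i = Ω i + (K / (N : ℝ)) * ∑ l, a i l * Real.sin (x l - x i + α)) :
    2 * bil x F + 4 * m * bil w F ≤ s * C1 - s * (1 - m * s) * bil x x
      + (2 * m - 2 * m ^ 2 * s) * bil w w := by
  obtain ⟨hD0p, hD0π⟩ := hD0
  have hsin : 0 < Real.sin D0 := Real.sin_pos_of_pos_of_lt_pi hD0p hD0π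
  have hcos : 0 < Real.cos α := Real.cos_pos_of_mem_Ioo ⟨by linarith [hα.1], hα.2⟩
  have hsα : 0 < Real.sin α := Real.sin_pos_of_pos_of_lt_pi hα.1 (by linarith [hα.2, Real.pi_pos])
  have hNp : (0 : ℝ) < N := by exact_mod_cast hN
  set R : ℝ := 1 + (r : ℝ) * (Ec : ℝ) with hR
  have hR' : 1 + (Ec : ℝ) * (r : ℝ) = R := by rw [hR]; ring
  have hRp : 0 < R := by positivity
  rw [hR'] at hC1
  set S : Fin N → ℝ := fun i => (K * Real.cos α) / N * ∑ l, a i l * Real.sin (x l - x i) with hS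
  set H : Fin N → ℝ := fun i => (K * Real.sin α) / N * ∑ l, a i l * Real.cos (x l - x i) with hH
  have hFe : F = fun i => Ω i + (S i + H i) := by
    funext i
    rw [hF, hS, hH]
    simp only [Real.sin_add, mul_add, Finset.sum_add_distrib, Finset.mul_sum]
    congr 2 <;> refine Finset.sum_congr rfl fun l _ => ?_ <;> ring
  set L : ℝ := K * Real.cos α * al * Real.sin D0 / (D0 * R) with hL
  have hLp : 0 < L := by positivity
  set X := bil x x with hX
  set W := bil w w with hW
  have hX0 : 0 ≤ X := bil_self_nonneg _
  have hW0 : 0 ≤ W := bil_self_nonneg _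
  -- dissipation
  have h1 : bil x S ≤ - L * X := by
    have h := bil_antisymm hN x (fun i l => a i l * Real.sin (x l - x i))
      (fun i j => by
        show _ = - (a j i * Real.sin (x i - x j))
        rw [hsym i j, ← neg_sub (x i) (x j), Real.sin_neg]; ring) (K * Real.cos α)
    have hE := bil_le_edges a G hadj hconn x r hr Ec hEc
    rw [← hR] at hE
    set Q := ∑ p ∈ Finset.filter (fun p : Fin N × Fin N => 0 < a p.1 p.2) Finset.univ,
        (x p.1 - x p.2) ^ 2 with hQ
    have hlow : al * (Real.sin D0 / D0) * Q
        ≤ ∑ i, ∑ l, (x i - x l) * (a i l * Real.sin (x i - x l)) := by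
      rw [hQ, Finset.mul_sum, ← Fintype.sum_prod_type'
        (f := fun i l => (x i - x l) * (a i l * Real.sin (x i - x l)))]
      have hb : ∀ p : Fin N × Fin N, Real.sin D0 / D0 * (x p.1 - x p.2) ^ 2
          ≤ (x p.1 - x p.2) * Real.sin (x p.1 - x p.2) :=
        fun p => mul_sin_bound _ _ hD0p hD0π (hx _ _)
      have hb0 : ∀ p : Fin N × Fin N, 0 ≤ Real.sin D0 / D0 * (x p.1 - x p.2) ^ 2 :=
        fun p => by positivity
      refine le_trans (Finset.sum_le_sum (g := fun p : Fin N × Fin N =>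
        (x p.1 - x p.2) * (a p.1 p.2 * Real.sin (x p.1 - x p.2))) ?_)
        (Finset.sum_le_sum_of_subset_of_nonneg (Finset.filter_subset _ _) ?_)
      · intro p hp
        have hp' := hal _ _ (Finset.mem_filter.1 hp).2
        have := mul_le_mul hp' (hb p) (hb0 p) (hnn _ _)
        calc _ = al * (Real.sin D0 / D0 * (x p.1 - x p.2) ^ 2) := by ring
          _ ≤ _ := this
          _ = _ := by ring
      · intro p _ _
        have := mul_nonneg (hnn p.1 p.2) ((hb0 p).trans (hb p))
        calc 0 ≤ _ := this
          _ = _ := by ring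
    have hneg : ∑ i, ∑ l, (x i - x l) * (a i l * Real.sin (x l - x i))
        = - ∑ i, ∑ l, (x i - x l) * (a i l * Real.sin (x i - x l)) := by
      simp only [← Finset.sum_neg_distrib]
      refine Finset.sum_congr rfl fun i _ => Finset.sum_congr rfl fun l _ => ?_
      rw [← neg_sub (x i) (x l), Real.sin_neg]; ring
    rw [hneg] at h
    rw [hS, h]
    have h5 : L * X ≤ L * (R * Q) := mul_le_mul_of_nonneg_left hE hLp.le
    have h6 : L * (R * Q) = K * Real.cos α * (al * (Real.sin D0 / D0) * Q) := by
      rw [hL]; field_simp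
    have h7 := mul_le_mul_of_nonneg_left hlow (by positivity : 0 ≤ K * Real.cos α)
    linarith
  -- the bound on S
  have h7 : bil S S ≤ 2 * (K ^ 2 * Real.cos α ^ 2 * au ^ 2) * X := by
    refine (bil_self_le S).trans ?_
    have hi : ∀ i, S i ^ 2 ≤ (K * Real.cos α) ^ 2 / N * au ^ 2 * ∑ l, (x i - x l) * (x i - x l) := by
      intro i
      have hcs : (∑ l, a i l * Real.sin (x l - x i)) ^ 2
          ≤ N * ∑ l, (a i l * Real.sin (x l - x i)) ^ 2 := by
        have := sq_sum_le_card_mul_sum_sq (s := (Finset.univ : Finset (Fin N)))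
          (f := fun l => a i l * Real.sin (x l - x i))
        simpa using this
      have hcs2 : ∑ l, (a i l * Real.sin (x l - x i)) ^ 2
          ≤ au ^ 2 * ∑ l, (x i - x l) * (x i - x l) := by
        rw [Finset.mul_sum]
        refine Finset.sum_le_sum fun l _ => ?_
        rw [mul_pow]
        refine mul_le_mul (pow_le_pow_left₀ (hnn _ _) (hau _ _) 2) ?_ (sq_nonneg _) (sq_nonneg _)
        have := Real.abs_sin_le_abs (x := x l - x i)
        have h2 := sq_le_sq.2 this
        nlinarith
      have h3 := hcs.trans (mul_le_mul_of_nonneg_left hcs2 hNp.le)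
      rw [hS]
      simp only [mul_pow]
      calc _ ≤ ((K * Real.cos α) / N) ^ 2 * (N * (au ^ 2 * ∑ l, (x i - x l) * (x i - x l))) := by
            exact mul_le_mul_of_nonneg_left h3 (sq_nonneg _)
        _ = _ := by field_simp
    have hsum := Finset.sum_le_sum (s := Finset.univ) (fun i _ => hi i)
    rw [← Finset.mul_sum] at hsum
    have hXe : ∑ i, ∑ l, (x i - x l) * (x i - x l) = X := rfl
    rw [hXe] at hsum
    calc _ ≤ 2 * N * ((K * Real.cos α) ^ 2 / N * au ^ 2 * X) :=
          mul_le_mul_of_nonneg_left hsum (by positivity)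
      _ = _ := by field_simp
  have h8 : bil H H ≤ 4 * (N ^ 2 * K ^ 2 * au ^ 2 * Real.sin α ^ 2) := by
    refine (bil_self_le H).trans ?_
    have hi : ∀ i, H i ^ 2 ≤ (K * Real.sin α * au) ^ 2 := by
      intro i
      have hab : |∑ l, a i l * Real.cos (x l - x i)| ≤ N * au := by
        refine (Finset.abs_sum_le_sum_abs _ _).trans ?_
        have : ∀ l ∈ (Finset.univ : Finset (Fin N)), |a i l * Real.cos (x l - x i)| ≤ au := by
          intro l _
          rw [abs_mul, abs_of_nonneg (hnn i l)]
          calc _ ≤ au * 1 := mul_le_mul (hau _ _) (Real.abs_cos_le_one _) (abs_nonneg _) hau0.le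
            _ = au := mul_one _
        simpa using Finset.sum_le_card_nsmul _ _ _ this
      refine sq_le_sq.2 ?_
      rw [hH]
      simp only [abs_mul (K * Real.sin α / N)]
      rw [abs_of_pos (by positivity : 0 < K * Real.sin α / N),
        abs_of_pos (by positivity : 0 < K * Real.sin α * au)]
      calc _ ≤ K * Real.sin α / N * (N * au) := mul_le_mul_of_nonneg_left hab (by positivity)
        _ = _ := by field_simp
    have hsum := Finset.sum_le_card_nsmul Finset.univ _ _ (fun i _ => hi i)
    simp only [Finset.card_univ, Fintype.card_fin, nsmul_eq_mul] at hsum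
    have := mul_le_mul_of_nonneg_left hsum (by positivity : 0 ≤ 2 * (N : ℝ))
    have hp : 0 ≤ (N : ℝ) ^ 2 * K ^ 2 * au ^ 2 * Real.sin α ^ 2 := by positivity
    calc _ ≤ _ := this
      _ = 2 * (N ^ 2 * K ^ 2 * au ^ 2 * Real.sin α ^ 2) := by ring
      _ ≤ _ := by linarith
  have h9 : s * C1 = (3 / L + 12 * m) * bil Ω Ω
      + 3 * (4 * (N ^ 2 * K ^ 2 * au ^ 2 * Real.sin α ^ 2)) * (1 / L + 4 * m) := by
    rw [hC1, hL, ← hs]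
    field_simp
    ring
  have h10 : 36 * m * (K ^ 2 * Real.cos α ^ 2 * au ^ 2) ≤ L := by
    have := mul_le_mul_of_nonneg_left hmK2.le
      (by positivity : 0 ≤ 36 * K * Real.cos α ^ 2 * au ^ 2)
    calc _ = 36 * K * Real.cos α ^ 2 * au ^ 2 * (m * K) := by ring
      _ ≤ _ := this
      _ = L := by rw [hL]; field_simp
  have h11 : s ≤ L := by
    have := mul_le_mul_of_nonneg_left hKbig.lt.le (by positivity : 0 ≤ L)
    have e : L * (R / (al * Real.cos α) * (D0 / Real.sin D0)) = s * s := by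
      rw [hL, hs]; field_simp
    rw [e] at this
    exact le_of_mul_le_mul_right this hs0
  have y2 := bil_young x Ω (L / 3) (by positivity)
  have y3 := bil_young x H (L / 3) (by positivity)
  have y4 := bil_young w Ω (1 / 6) (by positivity)
  have y5 := bil_young w H (1 / 6) (by positivity)
  have y6 := bil_young w S (1 / 2) (by positivity)
  rw [← hX] at y2 y3
  rw [← hW] at y4 y5 y6
  have eL : 1 / (L / 3) = 3 * (1 / L) := by field_simp
  have eL' : 3 / L = 3 * (1 / L) := by ring
  rw [eL] at y2 y3
  rw [h9, hFe, bil_add, bil_add, bil_add, bil_add, eL']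
  have hiL : 0 < 1 / L := by positivity
  set M := 4 * ((N : ℝ) ^ 2 * K ^ 2 * au ^ 2 * Real.sin α ^ 2) with hM
  set P := K ^ 2 * Real.cos α ^ 2 * au ^ 2 with hP
  have z3 : 3 * (1 / L) * bil H H ≤ 3 * (1 / L) * M := mul_le_mul_of_nonneg_left h8 (by positivity)
  have z4 := mul_le_mul_of_nonneg_left y4 (by positivity : 0 ≤ 2 * m)
  have z5 := mul_le_mul_of_nonneg_left y5 (by positivity : 0 ≤ 2 * m)
  have z6 := mul_le_mul_of_nonneg_left y6 (by positivity : 0 ≤ 2 * m)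
  have z5' : 12 * m * bil H H ≤ 12 * m * M := mul_le_mul_of_nonneg_left h8 (by positivity)
  have z6' : 4 * m * bil S S ≤ 4 * m * (2 * P * X) := mul_le_mul_of_nonneg_left h7 (by positivity)
  have z7 : 36 * m * P * X ≤ L * X := mul_le_mul_of_nonneg_right h10 hX0
  have z8 : s * X ≤ L * X := mul_le_mul_of_nonneg_right h11 hX0
  have z9 : 0 ≤ (1 / 8 - m * s) * (m * W) := mul_nonneg (by linarith) (by positivity)
  have z10 : 0 ≤ s * (m * s) * X := by positivity
  have z11 : 0 ≤ L * X := by positivity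
  have z12 : 0 ≤ m * W := by positivity
  norm_num at z4 z5 z6
  ring_nf at *
  linarith

lemma bil_hasDerivAt {N : ℕ} (f g : Fin N → ℝ → ℝ) (f' g' : Fin N → ℝ) (t : ℝ)
    (hf : ∀ i, HasDerivAt (f i) (f' i) t) (hg : ∀ i, HasDerivAt (g i) (g' i) t) :
    HasDerivAt (fun t => bil (fun i => f i t) (fun i => g i t))
      (bil f' (fun i => g i t) + bil (fun i => f i t) g') t := by
  unfold bil
  simp only [← Finset.sum_add_distrib]
  refine HasDerivAt.fun_sum fun i _ => HasDerivAt.fun_sum fun j _ => ?_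
  exact ((hf i).sub (hf j)).mul ((hg i).sub (hg j))

lemma bil_comm {N : ℕ} (f g : Fin N → ℝ) : bil f g = bil g f := by
  unfold bil
  exact Finset.sum_congr rfl fun i _ => Finset.sum_congr rfl fun j _ => mul_comm _ _

lemma bil_smul {N : ℕ} (f g : Fin N → ℝ) (c : ℝ) : bil f (fun i => c * g i) = c * bil f g := by
  unfold bil
  simp only [Finset.mul_sum]
  exact Finset.sum_congr rfl fun i _ => Finset.sum_congr rfl fun j _ => by ring

/-- Gronwall-type differential inequality for the energy functional `E₁`. -/
theorem energy_E1_differential_inequality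
    (N : ℕ) (hN : 0 < N)
    (a : Fin N → Fin N → ℝ)
    (hsym : ∀ i j, a i j = a j i)
    (hnn : ∀ i j, 0 ≤ a i j)
    (G : SimpleGraph (Fin N))
    (hadj : ∀ i j, G.Adj i j ↔ i ≠ j ∧ 0 < a i j)
    (hconn : G.Connected)
    (hEne : (Finset.filter (fun p : Fin N × Fin N => 0 < a p.1 p.2) Finset.univ).Nonempty)
    (r : ℕ)
    (hr : r = Finset.univ.sup (fun p : Fin N × Fin N => G.dist p.1 p.2))
    (Ec : ℕ)
    (hEc : Ec = (Finset.filter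
      (fun p : Fin N × Fin N => ¬ 0 < a p.1 p.2) Finset.univ).card)
    (al : ℝ)
    (hal : al = (Finset.filter (fun p : Fin N × Fin N => 0 < a p.1 p.2) Finset.univ).inf' hEne (fun p => a p.1 p.2))
    (au : ℝ)
    (hau : au = (Finset.filter (fun p : Fin N × Fin N => 0 < a p.1 p.2) Finset.univ).sup' hEne (fun p => a p.1 p.2))
    (m K α D0 : ℝ) (hm : 0 < m) (hK : 0 < K) (hα : 0 < α ∧ α < Real.pi / 2)
    (hD0 : 0 < D0 ∧ D0 < Real.pi)
    (Ω : Fin N → ℝ)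
    (θ : Fin N → ℝ → ℝ)
    (hθ : ∀ i, ContDiff ℝ 2 (θ i))
    (hODE : ∀ i, ∀ t ≥ (0 : ℝ),
      m * deriv (deriv (θ i)) t + deriv (θ i) t
        = Ω i + (K / (N : ℝ)) * ∑ l, a i l * Real.sin (θ l t - θ i t + α))
    (DΩ : ℝ) (hDΩ : DΩ = ∑ i, ∑ j, |Ω i - Ω j| ^ 2)
    (E1 : ℝ → ℝ)
    (hE1 : ∀ t, E1 t
      = 2 * m * (∑ i, ∑ j, (θ i t - θ j t) * (deriv (θ i) t - deriv (θ j) t))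
        + (1 - m * Real.sqrt K) * (∑ i, ∑ j, (θ i t - θ j t) ^ 2)
        + 2 * m ^ 2 * (∑ i, ∑ j, (deriv (θ i) t - deriv (θ j) t) ^ 2))
    (C1 : ℝ)
    (hC1 : C1
      = (3 * (1 + (Ec : ℝ) * (r : ℝ)) * D0 / (K * Real.sqrt K * al * Real.cos α * Real.sin D0)
          + 12 * m / Real.sqrt K) * DΩ
        + 12 * (N : ℝ) ^ 2 * Real.sqrt K * au ^ 2 * Real.sin α ^ 2
          * ((1 + (Ec : ℝ) * (r : ℝ)) * D0 / (al * Real.cos α * Real.sin D0) + 4 * m * K))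
    (hinit : E1 0 < D0 ^ 2 / 8)
    (hKbig : Real.sqrt K
      > ((1 + (r : ℝ) * (Ec : ℝ)) / (al * Real.cos α)) * (D0 / Real.sin D0))
    (hmK1 : m * Real.sqrt K < 1 / 8)
    (hmK2 : m * K
      < (al / (au ^ 2 * (1 + (r : ℝ) * (Ec : ℝ)) * Real.cos α)) * (Real.sin D0 / (36 * D0)))
    (hC1 : C1 < D0 ^ 2 / 16)
    :
    ∀ t ≥ (0 : ℝ), deriv E1 t ≤ Real.sqrt K * C1 - Real.sqrt K * E1 t := by
  have hs0 : 0 < Real.sqrt K := Real.sqrt_pos.2 hK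
  have hs : Real.sqrt K * Real.sqrt K = K := Real.mul_self_sqrt hK.le
  have hal' : ∀ i j, 0 < a i j → al ≤ a i j := by
    intro i j h
    rw [hal]
    exact Finset.inf'_le (fun p : Fin N × Fin N => a p.1 p.2) (b := (i, j)) (by simpa using h)
  have hal0 : 0 < al := by
    rw [hal, Finset.lt_inf'_iff]
    intro p hp
    exact (Finset.mem_filter.1 hp).2
  have hau1 : ∀ i j, 0 < a i j → a i j ≤ au := by
    intro i j h
    rw [hau]
    exact Finset.le_sup' (fun p : Fin N × Fin N => a p.1 p.2) (b := (i, j)) (by simpa using h)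
  have hau0 : 0 < au := by
    obtain ⟨p, hp⟩ := hEne
    have hp := (Finset.mem_filter.1 hp).2
    exact hp.trans_le (hau1 _ _ hp)
  have hau' : ∀ i j, a i j ≤ au := by
    intro i j
    by_cases h : 0 < a i j
    · exact hau1 i j h
    · linarith
  have hDΩ' : DΩ = bil Ω Ω := by
    rw [hDΩ]; unfold bil; simp only [sq_abs]; simp only [sq]
  rename_i hC1eq
  rw [hDΩ'] at hC1eq
  have hE1' : ∀ t, E1 t = 2 * m * bil (fun i => θ i t) (fun i => deriv (θ i) t)
      + (1 - m * Real.sqrt K) * bil (fun i => θ i t) (fun i => θ i t)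
      + 2 * m ^ 2 * bil (fun i => deriv (θ i) t) (fun i => deriv (θ i) t) := by
    intro t
    rw [hE1]; unfold bil; simp only [sq]
  have hd1 : ∀ i t, HasDerivAt (θ i) (deriv (θ i) t) t := fun i t =>
    ((hθ i).differentiable (by norm_num) t).hasDerivAt
  have hd2 : ∀ i t, HasDerivAt (deriv (θ i)) (deriv (deriv (θ i)) t) t := fun i t => by
    have h : ContDiff ℝ 1 (deriv (θ i)) := by
      have h2 : ContDiff ℝ (1 + 1) (θ i) := by simpa [one_add_one_eq_two] using hθ i
      exact (contDiff_succ_iff_deriv.1 h2).2.2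
    exact (h.differentiable (by norm_num) t).hasDerivAt
  have hDE : ∀ t, HasDerivAt E1
      (2 * m * (bil (fun i => deriv (θ i) t) (fun i => deriv (θ i) t)
          + bil (fun i => θ i t) (fun i => deriv (deriv (θ i)) t))
        + (1 - m * Real.sqrt K) * (bil (fun i => deriv (θ i) t) (fun i => θ i t)
          + bil (fun i => θ i t) (fun i => deriv (θ i) t))
        + 2 * m ^ 2 * (bil (fun i => deriv (deriv (θ i)) t) (fun i => deriv (θ i) t)
          + bil (fun i => deriv (θ i) t) (fun i => deriv (deriv (θ i)) t))) t := by
    intro t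
    rw [funext hE1']
    exact (((bil_hasDerivAt _ _ _ _ t (fun i => hd1 i t) (fun i => hd2 i t)).const_mul _).add
      ((bil_hasDerivAt _ _ _ _ t (fun i => hd1 i t) (fun i => hd1 i t)).const_mul _)).add
      ((bil_hasDerivAt _ _ _ _ t (fun i => hd2 i t) (fun i => hd2 i t)).const_mul _)
  -- the inequality at one time, under the energy bound
  have hpt : ∀ t ≥ (0 : ℝ), E1 t ≤ D0 ^ 2 / 8 →
      deriv E1 t ≤ Real.sqrt K * C1 - Real.sqrt K * E1 t := by
    intro t ht hEt
    have hX0 := bil_self_nonneg (fun i => θ i t)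
    have hx : ∀ i j, |θ i t - θ j t| ≤ D0 := by
      intro i j
      have hp := pair_le_bil (fun i => θ i t) i j
      have hy := bil_young (fun i => θ i t) (fun i => - deriv (θ i) t) (1 / (2 * m)) (by positivity)
      have e1 : bil (fun i => θ i t) (fun i => - deriv (θ i) t)
          = - bil (fun i => θ i t) (fun i => deriv (θ i) t) := by
        have := bil_smul (fun i => θ i t) (fun i => deriv (θ i) t) (-1)
        simpa using this
      have e2 : bil (fun i => - deriv (θ i) t) (fun i => - deriv (θ i) t)
          = bil (fun i => deriv (θ i) t) (fun i => deriv (θ i) t) := by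
        unfold bil
        exact Finset.sum_congr rfl fun i _ => Finset.sum_congr rfl fun j _ => by ring
      rw [e1, e2] at hy
      have hE := hE1' t
      generalize bil (fun i => θ i t) (fun i => θ i t) = X at *
      generalize bil (fun i => θ i t) (fun i => deriv (θ i) t) = Y at *
      generalize bil (fun i => deriv (θ i) t) (fun i => deriv (θ i) t) = W at *
      have hy2 := mul_le_mul_of_nonneg_left hy hm.le
      have e3 : m * (1 / (2 * m) * X + 1 / (1 / (2 * m)) * W) = X / 2 + 2 * m ^ 2 * W := by
        field_simp
      rw [e3] at hy2
      have h8 : 0 ≤ (1 / 8 - m * Real.sqrt K) * X := mul_nonneg (by linarith) hX0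
      have h9 : 3 / 8 * X ≤ E1 t := by rw [hE]; linarith
      refine abs_le_of_sq_le_sq ?_ hD0.1.le
      nlinarith [sq_nonneg D0]
    have hcore := core_ineq N hN a hsym hnn G hadj hconn r hr Ec hEc al au hal0 hal' hau0 hau'
      m K α D0 (Real.sqrt K) hm hK hα hD0 hs0 hs Ω (fun i => θ i t) (fun i => deriv (θ i) t) hx
      C1 hC1eq hKbig hmK1 hmK2
      (fun i => deriv (θ i) t + m * deriv (deriv (θ i)) t)
      (fun i => by rw [← hODE i t ht]; ring)
    rw [bil_add, bil_add, bil_smul, bil_smul] at hcore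
    rw [(hDE t).deriv, hE1' t, bil_comm (fun i => deriv (θ i) t) (fun i => θ i t),
      bil_comm (fun i => deriv (deriv (θ i)) t) (fun i => deriv (θ i) t)]
    nlinarith [hcore]
  intro t ht
  refine hpt t ht ?_
  have hcont : ContinuousOn E1 (Set.Icc 0 t) := fun u _ =>
    (hDE u).continuousAt.continuousWithinAt
  refine image_le_of_deriv_right_lt_deriv_boundary (f' := deriv E1) (B := fun _ => D0 ^ 2 / 8)
    (B' := fun _ => 0) hcont ?_ hinit.le (fun u => hasDerivAt_const u _) ?_
    (Set.right_mem_Icc.2 ht)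
  · intro u _
    exact (hDE u).differentiableAt.hasDerivAt.hasDerivWithinAt
  · intro u hu he
    have h := hpt u hu.1 he.le
    rw [he] at h
    have hD : 0 < D0 ^ 2 := pow_pos hD0.1 2
    have : Real.sqrt K * (C1 - D0 ^ 2 / 8) < 0 := mul_neg_of_pos_of_neg hs0 (by linarith)
    linarith
end

section
/- Under the assumptions of the differential-inequality lemma (symmetric connected graph, twice continuously differentiable solution θ of m θ_i'' + θ_i' = Ω_i + (K/N) Σ_l a_{il} sin(θ_l − θ_i + α), E₁(0) < D₀²/8 with D₀ ∈ (0,π), √K > ((1+r|E^c|)/(a_l cos α)) · D₀/sin D₀, m√K < 1/8, mK < (a_l/(a_u²(1+r|E^c|) cos α)) · sin D₀/(36 D₀), C₁ < D₀²/16), one has E₁(t) < D₀²/8 and the phase diameter satisfies D(θ(t)) = max_{1≤i,j≤N}|θ_i(t) − θ_j(t)| < D₀ < π for all t ∈ [0,∞). -/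
open Finset Real

lemma kur_walk {N : ℕ} (G : SimpleGraph (Fin N)) (x : Fin N → ℝ) {i j : Fin N} (p : G.Walk i j) :
    0 ≤ (p.darts.map (fun d => (x d.toProd.1 - x d.toProd.2)^2)).sum ∧
    (x i - x j)^2 ≤ p.length * (p.darts.map (fun d => (x d.toProd.1 - x d.toProd.2)^2)).sum := by
  induction p with
  | nil => simp
  | @cons u v w h p ih =>
    obtain ⟨h0, ih⟩ := ih
    simp only [SimpleGraph.Walk.darts_cons, List.map_cons, List.sum_cons, SimpleGraph.Walk.length_cons]
    set s := (p.darts.map (fun d => (x d.toProd.1 - x d.toProd.2)^2)).sum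
    refine ⟨by positivity, ?_⟩
    push_cast
    have hn : (0:ℝ) ≤ (p.length : ℝ) := Nat.cast_nonneg _
    generalize (p.length : ℝ) = n at *
    have e : x u - x w = (x u - x v) + (x v - x w) := by ring
    rw [e]
    generalize x u - x v = a at *
    generalize x v - x w = b at *
    have key : 2 * a * b ≤ n * a^2 + s := by
      refine le_trans (le_abs_self _) (abs_le_of_sq_le_sq ?_ (by positivity))
      nlinarith [mul_le_mul_of_nonneg_left ih (sq_nonneg a), sq_nonneg (n * a^2 - s)]
    nlinarith

lemma kur_graph {N : ℕ} (a : Fin N → Fin N → ℝ) (G : SimpleGraph (Fin N))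
    (hadj : ∀ i j, G.Adj i j ↔ i ≠ j ∧ 0 < a i j) (hconn : G.Connected) (r : ℕ)
    (hr : r = Finset.univ.sup (fun p : Fin N × Fin N => G.dist p.1 p.2))
    (Ec : ℕ)
    (hEc : Ec = (Finset.filter
      (fun p : Fin N × Fin N => ¬ 0 < a p.1 p.2) Finset.univ).card) (x : Fin N → ℝ) :
    ∑ i, ∑ j, (x i - x j)^2 ≤ (1 + (r:ℝ) * Ec) *
      ∑ p ∈ Finset.filter (fun p : Fin N × Fin N => 0 < a p.1 p.2) Finset.univ, (x p.1 - x p.2)^2 := by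
  set S := ∑ p ∈ Finset.filter (fun p : Fin N × Fin N => 0 < a p.1 p.2) Finset.univ, (x p.1 - x p.2)^2 with hS
  have hS0 : 0 ≤ S := Finset.sum_nonneg fun _ _ => sq_nonneg _
  have hb : ∀ i j, (x i - x j)^2 ≤ r * S := by
    intro i j
    obtain ⟨p, hp, hl⟩ := hconn.exists_path_of_dist i j
    obtain ⟨h0, h1⟩ := kur_walk G x p
    have hlr : (p.length : ℝ) ≤ r := by
      rw [hl, hr]
      exact_mod_cast Finset.le_sup (f := fun p : Fin N × Fin N => G.dist p.1 p.2) (Finset.mem_univ (i, j))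
    have hsum : (p.darts.map (fun d => (x d.toProd.1 - x d.toProd.2)^2)).sum ≤ S := by
      have nd : (p.darts.map (fun d => d.toProd)).Nodup :=
        (p.darts_nodup_of_support_nodup hp.support_nodup).map SimpleGraph.Dart.toProd_injective
      have e : (p.darts.map (fun d => (x d.toProd.1 - x d.toProd.2)^2)).sum
          = ∑ q ∈ (p.darts.map (fun d => d.toProd)).toFinset, (x q.1 - x q.2)^2 := by
        rw [List.sum_toFinset _ nd, List.map_map]; rfl
      rw [e, hS]
      apply Finset.sum_le_sum_of_subset_of_nonneg
      · intro q hq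
        simp only [List.mem_toFinset, List.mem_map] at hq
        obtain ⟨d, -, rfl⟩ := hq
        simp only [Finset.mem_filter, Finset.mem_univ, true_and]
        exact ((hadj _ _).1 d.adj).2
      · intros; positivity
    calc _ ≤ _ := h1
      _ ≤ r * S := by gcongr
  rw [← Fintype.sum_prod_type' (f := fun i j => (x i - x j)^2),
    ← Finset.sum_filter_add_sum_filter_not Finset.univ (fun p : Fin N × Fin N => 0 < a p.1 p.2)]
  have h2 := Finset.sum_le_card_nsmul (Finset.filter (fun p : Fin N × Fin N => ¬ 0 < a p.1 p.2) Finset.univ)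
    (fun p => (x p.1 - x p.2)^2) (r * S) (fun p _ => hb _ _)
  rw [← hEc, nsmul_eq_mul] at h2
  rw [← hS]
  nlinarith

lemma kur_bilin {N : ℕ} (u v : Fin N → ℝ) :
    ∑ i, ∑ j, (u i - u j) * (v i - v j) = 2 * N * ∑ i, u i * v i - 2 * (∑ i, u i) * ∑ i, v i := by
  have : ∀ i j, (u i - u j) * (v i - v j) = u i * v i + u j * v j - u i * v j - v i * u j := by
    intros; ring
  simp only [this, Finset.sum_sub_distrib, Finset.sum_add_distrib, ← Finset.mul_sum, ← Finset.sum_mul]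
  have e : ∑ i, ∑ _j : Fin N, u i * v i = N * ∑ i, u i * v i := by
    rw [Finset.mul_sum]
    simp
  have e2 : ∑ i, u i * ∑ _j : Fin N, v i = N * ∑ i, u i * v i := by
    rw [← e]
    simp only [Finset.mul_sum]
  rw [e2]
  simp
  ring

lemma kur_sumT {N : ℕ} (a : Fin N → Fin N → ℝ) (hsym : ∀ i j, a i j = a j i) (x : Fin N → ℝ) :
    ∑ i, ∑ l, a i l * sin (x l - x i) = 0 := by
  have h : ∑ i, ∑ l, a i l * sin (x l - x i) = - ∑ i, ∑ l, a i l * sin (x l - x i) := by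
    conv_lhs => rw [Finset.sum_comm]
    simp only [← Finset.sum_neg_distrib]
    refine Finset.sum_congr rfl fun i _ => Finset.sum_congr rfl fun l _ => ?_
    rw [hsym l i, ← neg_sub (x l) (x i), sin_neg]; ring
  linarith

lemma kur_dT {N : ℕ} (a : Fin N → Fin N → ℝ) (hsym : ∀ i j, a i j = a j i) (x : Fin N → ℝ) :
    ∑ i, ∑ j, (x i - x j) * ((∑ l, a i l * sin (x l - x i)) - (∑ l, a j l * sin (x l - x j)))
     = - (N * ∑ i, ∑ l, a i l * ((x i - x l) * sin (x i - x l))) := by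
  rw [kur_bilin x (fun i => ∑ l, a i l * sin (x l - x i)), kur_sumT a hsym x]
  have h1 : ∑ i, x i * ∑ l, a i l * sin (x l - x i) = ∑ i, ∑ l, a i l * (x i * sin (x l - x i)) := by
    simp only [Finset.mul_sum]
    refine Finset.sum_congr rfl fun i _ => Finset.sum_congr rfl fun l _ => ?_
    ring
  have h2 : ∑ i, ∑ l, a i l * (x i * sin (x l - x i)) = ∑ i, ∑ l, a i l * (x l * sin (x i - x l)) := by
    conv_lhs => rw [Finset.sum_comm]
    refine Finset.sum_congr rfl fun i _ => Finset.sum_congr rfl fun l _ => ?_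
    rw [hsym l i]
  have h3 : ∑ i, ∑ l, a i l * ((x i - x l) * sin (x i - x l)) =
      - (∑ i, ∑ l, a i l * (x i * sin (x l - x i)) + ∑ i, ∑ l, a i l * (x l * sin (x i - x l))) := by
    simp only [← Finset.sum_neg_distrib, ← Finset.sum_add_distrib]
    refine Finset.sum_congr rfl fun i _ => Finset.sum_congr rfl fun l _ => ?_
    rw [← neg_sub (x l) (x i), sin_neg]; ring
  rw [h3, ← h2, h1]; ring

lemma kur_dT2 {N : ℕ} (a : Fin N → Fin N → ℝ) (hsym : ∀ i j, a i j = a j i) (x : Fin N → ℝ)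
    (au : ℝ) (hau : ∀ i j, |a i j| ≤ au) :
    ∑ i, ∑ j, ((∑ l, a i l * sin (x l - x i)) - (∑ l, a j l * sin (x l - x j)))^2
     ≤ 2 * N^2 * au^2 * ∑ i, ∑ j, (x i - x j)^2 := by
  have h := kur_bilin (fun i => ∑ l, a i l * sin (x l - x i)) (fun i => ∑ l, a i l * sin (x l - x i))
  simp only [kur_sumT a hsym x, ← sq] at h
  rw [h]
  have h1 : ∀ i, (∑ l, a i l * sin (x l - x i))^2 ≤ N * (au^2 * ∑ l, (x i - x l)^2) := by
    intro i
    have := sq_sum_le_card_mul_sum_sq (s := Finset.univ) (f := fun l => a i l * sin (x l - x i))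
    simp only [Finset.card_univ, Fintype.card_fin] at this
    refine this.trans ?_
    have hms : au^2 * ∑ l, (x i - x l)^2 = ∑ l, au^2 * (x i - x l)^2 := Finset.mul_sum _ _ _
    rw [hms]
    refine mul_le_mul_of_nonneg_left (Finset.sum_le_sum fun l _ => ?_) (Nat.cast_nonneg _)
    rw [mul_pow]
    have e1 : a i l ^2 ≤ au^2 := sq_le_sq' (by linarith [(abs_le.1 (hau i l)).1]) (abs_le.1 (hau i l)).2
    have e2 : sin (x l - x i)^2 ≤ (x i - x l)^2 := by
      rw [← neg_sub (x i) (x l), sin_neg, neg_sq]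
      exact sq_le_sq.2 abs_sin_le_abs
    gcongr
  have h2 := Finset.sum_le_sum (s := Finset.univ) fun i _ => h1 i
  rw [← Finset.mul_sum, ← Finset.mul_sum] at h2
  have hn : (0:ℝ) ≤ N := Nat.cast_nonneg _
  nlinarith [mul_le_mul_of_nonneg_left h2 hn]

lemma kur_sin (D0 d : ℝ) (h0 : 0 < D0) (hpi : D0 < π) (hd : |d| ≤ D0) :
    sin D0 / D0 * d^2 ≤ d * sin d := by
  have main : ∀ d, 0 ≤ d → d ≤ D0 → sin D0 / D0 * d^2 ≤ d * sin d := by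
    intro d hd0 hd1
    have hc := strictConcaveOn_sin_Icc.concaveOn.2 (show (0:ℝ) ∈ Set.Icc 0 π from ⟨le_rfl, pi_pos.le⟩)
      (show D0 ∈ Set.Icc 0 π from ⟨h0.le, hpi.le⟩)
      (show 0 ≤ 1 - d / D0 by rw [sub_nonneg, div_le_one h0]; exact hd1) (show 0 ≤ d / D0 by positivity) (by ring)
    simp only [smul_eq_mul, sin_zero, mul_zero, zero_add] at hc
    rw [div_mul_cancel₀ _ h0.ne'] at hc
    calc _ = d * (d / D0 * sin D0) := by ring
      _ ≤ _ := mul_le_mul_of_nonneg_left hc hd0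
  rcases le_total 0 d with h | h
  · exact main d h (by rwa [abs_of_nonneg h] at hd)
  · have := main (-d) (by linarith) (by rwa [abs_of_nonpos h] at hd)
    simpa using this

lemma kur_diss {N : ℕ} (a : Fin N → Fin N → ℝ) (hnn : ∀ i j, 0 ≤ a i j) (G : SimpleGraph (Fin N))
    (hadj : ∀ i j, G.Adj i j ↔ i ≠ j ∧ 0 < a i j) (hconn : G.Connected) (r : ℕ)
    (hr : r = Finset.univ.sup (fun p : Fin N × Fin N => G.dist p.1 p.2))
    (Ec : ℕ)
    (hEc : Ec = (Finset.filter
      (fun p : Fin N × Fin N => ¬ 0 < a p.1 p.2) Finset.univ).card)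
    (al : ℝ) (hal0 : 0 < al) (hal : ∀ i j, 0 < a i j → al ≤ a i j)
    (D0 : ℝ) (h0 : 0 < D0) (hpi : D0 < π) (x : Fin N → ℝ) (hx : ∀ i j, |x i - x j| ≤ D0) :
    al * (sin D0 / D0) / (1 + r * Ec) * ∑ i, ∑ j, (x i - x j)^2
      ≤ ∑ i, ∑ l, a i l * ((x i - x l) * sin (x i - x l)) := by
  have hg := kur_graph a G hadj hconn r hr Ec hEc x
  have hs : 0 < sin D0 := sin_pos_of_pos_of_lt_pi h0 hpi
  have hp : (0:ℝ) < 1 + r * Ec := by positivity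
  have hd : ∀ i j, 0 ≤ (x i - x j) * sin (x i - x j) := fun i j =>
    le_trans (by positivity) (kur_sin D0 _ h0 hpi (hx i j))
  have hmain : al * (sin D0 / D0) * (∑ p ∈ Finset.filter (fun p : Fin N × Fin N => 0 < a p.1 p.2) Finset.univ, (x p.1 - x p.2)^2) ≤ ∑ i, ∑ l, a i l * ((x i - x l) * sin (x i - x l)) := by
    rw [← Fintype.sum_prod_type' (f := fun i l => a i l * ((x i - x l) * sin (x i - x l))), Finset.mul_sum]
    refine le_trans (Finset.sum_le_sum (g := fun p : Fin N × Fin N => a p.1 p.2 * ((x p.1 - x p.2) * sin (x p.1 - x p.2))) ?_)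
      (Finset.sum_le_sum_of_subset_of_nonneg (Finset.filter_subset _ _) ?_)
    · intro p hp
      rw [Finset.mem_filter] at hp
      rw [mul_assoc]
      have := hal _ _ hp.2
      exact mul_le_mul this (kur_sin D0 _ h0 hpi (hx _ _)) (by positivity) (hnn _ _)
    · intro p _ _
      exact mul_nonneg (hnn _ _) (hd _ _)
  refine le_trans ?_ hmain
  rw [div_mul_eq_mul_div, div_le_iff₀ hp, mul_assoc]
  rw [mul_assoc _ _ (1 + (r:ℝ) * Ec), mul_comm _ (1 + (r:ℝ) * Ec)]
  rw [← mul_assoc]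
  gcongr

lemma kur_pt (m q lam d w w' g c s : ℝ) (hm : 0 < m) (hq : 0 < q) (hmq : m * q < 1/8) (hl : 0 < lam)
    (h : m * w' = -w + g + c + s) :
    2 * m * (w * w + d * w') + (1 - m * q) * (2 * d * w) + 2 * m^2 * (2 * w * w')
      + q / 2 * (2 * m * (d * w) + (1 - m * q) * d^2 + 2 * m^2 * w^2)
    ≤ 2 * (d * s) + 12 * m * s^2 + (2 * lam / 3 + q / 2) * d^2 + (3 / lam + 12 * m) * (g^2 + c^2) := by
  have y : ∀ g, 2 * d * g ≤ lam / 3 * d^2 + 3 / lam * g^2 := by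
    intro g
    have : lam / 3 * d^2 + 3 / lam * g^2 - 2 * d * g = (lam * d - 3 * g)^2 / (3 * lam) := by
      field_simp; ring
    have h2 : 0 ≤ (lam * d - 3 * g)^2 / (3 * lam) := by positivity
    linarith
  have z : ∀ g, 4 * m * w * g ≤ m / 3 * w^2 + 12 * m * g^2 := by
    intro g
    nlinarith [mul_nonneg hm.le (sq_nonneg (w - 6 * g))]
  have v : - (m * q * (d * w)) ≤ m / 2 * w^2 + m * q^2 / 2 * d^2 := by
    nlinarith [mul_nonneg hm.le (sq_nonneg (w + q * d))]
  have u : m * (m * q) * w^2 ≤ m * (1/8) * w^2 := by gcongr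
  have e : 2 * m * (w * w + d * w') + (1 - m * q) * (2 * d * w) + 2 * m^2 * (2 * w * w')
      = 2 * m * w^2 + 2 * d * (m * w') + (1 - m * q) * (2 * d * w) + 4 * m * w * (m * w') := by ring
  rw [e, h]
  nlinarith [y g, y c, z g, z c, z s, mul_nonneg hm.le (sq_nonneg w)]

set_option maxHeartbeats 4000000 in
/-- uniform bound of the energy `E₁` and of the phase diameter. -/
theorem energy_E1_and_phase_diameter_bounded
    (N : ℕ) (hN : 0 < N)
    (a : Fin N → Fin N → ℝ)
    (hsym : ∀ i j, a i j = a j i)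
    (hnn : ∀ i j, 0 ≤ a i j)
    (G : SimpleGraph (Fin N))
    (hadj : ∀ i j, G.Adj i j ↔ i ≠ j ∧ 0 < a i j)
    (hconn : G.Connected)
    (hEne : (Finset.filter (fun p : Fin N × Fin N => 0 < a p.1 p.2) Finset.univ).Nonempty)
    (r : ℕ)
    (hr : r = Finset.univ.sup (fun p : Fin N × Fin N => G.dist p.1 p.2))
    (Ec : ℕ)
    (hEc : Ec = (Finset.filter
      (fun p : Fin N × Fin N => ¬ 0 < a p.1 p.2) Finset.univ).card)
    (al : ℝ)
    (hal : al = (Finset.filter (fun p : Fin N × Fin N => 0 < a p.1 p.2) Finset.univ).inf' hEne (fun p => a p.1 p.2))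
    (au : ℝ)
    (hau : au = (Finset.filter (fun p : Fin N × Fin N => 0 < a p.1 p.2) Finset.univ).sup' hEne (fun p => a p.1 p.2))
    (m K α D0 : ℝ) (hm : 0 < m) (hK : 0 < K) (hα : 0 < α ∧ α < Real.pi / 2)
    (hD0 : 0 < D0 ∧ D0 < Real.pi)
    (Ω : Fin N → ℝ)
    (θ : Fin N → ℝ → ℝ)
    (hθ : ∀ i, ContDiff ℝ 2 (θ i))
    (hODE : ∀ i, ∀ t ≥ (0 : ℝ),
      m * deriv (deriv (θ i)) t + deriv (θ i) t
        = Ω i + (K / (N : ℝ)) * ∑ l, a i l * Real.sin (θ l t - θ i t + α))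
    (DΩ : ℝ) (hDΩ : DΩ = ∑ i, ∑ j, |Ω i - Ω j| ^ 2)
    (E1 : ℝ → ℝ)
    (hE1 : ∀ t, E1 t
      = 2 * m * (∑ i, ∑ j, (θ i t - θ j t) * (deriv (θ i) t - deriv (θ j) t))
        + (1 - m * Real.sqrt K) * (∑ i, ∑ j, (θ i t - θ j t) ^ 2)
        + 2 * m ^ 2 * (∑ i, ∑ j, (deriv (θ i) t - deriv (θ j) t) ^ 2))
    (C1 : ℝ)
    (hC1 : C1
      = (3 * (1 + (Ec : ℝ) * (r : ℝ)) * D0 / (K * Real.sqrt K * al * Real.cos α * Real.sin D0)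
          + 12 * m / Real.sqrt K) * DΩ
        + 12 * (N : ℝ) ^ 2 * Real.sqrt K * au ^ 2 * Real.sin α ^ 2
          * ((1 + (Ec : ℝ) * (r : ℝ)) * D0 / (al * Real.cos α * Real.sin D0) + 4 * m * K))
    (hinit : E1 0 < D0 ^ 2 / 8)
    (hKbig : Real.sqrt K
      > ((1 + (r : ℝ) * (Ec : ℝ)) / (al * Real.cos α)) * (D0 / Real.sin D0))
    (hmK1 : m * Real.sqrt K < 1 / 8)
    (hmK2 : m * K
      < (al / (au ^ 2 * (1 + (r : ℝ) * (Ec : ℝ)) * Real.cos α)) * (Real.sin D0 / (36 * D0)))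
    (hC1 : C1 < D0 ^ 2 / 16)
    :
    ∀ t ≥ (0 : ℝ), E1 t < D0 ^ 2 / 8 ∧ ∀ i j, |θ i t - θ j t| < D0 := by
  obtain ⟨hα0, hα1⟩ := hα
  obtain ⟨hD, hDpi⟩ := hD0
  have hsin : 0 < sin D0 := sin_pos_of_pos_of_lt_pi hD hDpi
  have hcos : 0 < cos α := cos_pos_of_mem_Ioo ⟨by linarith, hα1⟩
  have hNR : (0:ℝ) < N := by exact_mod_cast hN
  have hal0 : 0 < al := by
    rw [hal, Finset.lt_inf'_iff]
    intro p hp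
    exact (Finset.mem_filter.1 hp).2
  have hal' : ∀ i j, 0 < a i j → al ≤ a i j := by
    intro i j h
    rw [hal]
    exact Finset.inf'_le (fun p : Fin N × Fin N => a p.1 p.2)
      (Finset.mem_filter.2 ⟨Finset.mem_univ (i, j), h⟩)
  have hau1 : ∀ i j, 0 < a i j → a i j ≤ au := by
    intro i j h
    rw [hau]
    exact Finset.le_sup' (fun p : Fin N × Fin N => a p.1 p.2)
      (Finset.mem_filter.2 ⟨Finset.mem_univ (i, j), h⟩)
  have hau0 : 0 < au := by
    obtain ⟨p, hp⟩ := hEne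
    have := (Finset.mem_filter.1 hp).2
    exact lt_of_lt_of_le this (hau1 _ _ this)
  have hau' : ∀ i j, |a i j| ≤ au := by
    intro i j
    rw [abs_of_nonneg (hnn i j)]
    rcases (hnn i j).eq_or_lt with h | h
    · rw [← h]; exact hau0.le
    · exact hau1 i j h
  clear hal hau
  obtain ⟨q, hq⟩ : ∃ q, q = √K := ⟨_, rfl⟩
  have hq0 : 0 < q := by rw [hq]; exact sqrt_pos.2 hK
  have hqK : K = q^2 := by rw [hq, sq_sqrt hK.le]
  rw [← hq] at hKbig hmK1
  simp only [← hq] at hE1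
  rename_i hC1eq
  rw [← hq] at hC1eq
  have hB : (0:ℝ) < 1 + r * Ec := by positivity
  obtain ⟨lam, hlam⟩ : ∃ lam, lam = K * cos α * (al * (sin D0 / D0) / (1 + r * Ec)) := ⟨_, rfl⟩
  have hlam0 : 0 < lam := by rw [hlam]; positivity
  have hlq : q < lam := by
    have : ((1 + (r : ℝ) * (Ec : ℝ)) / (al * Real.cos α)) * (D0 / Real.sin D0) = q^2 / lam := by
      rw [hlam, hqK]; field_simp
    rw [this, gt_iff_lt, div_lt_iff₀ hlam0] at hKbig
    nlinarith
  have hm2 : 36 * m * K^2 * au^2 * cos α^2 < lam := by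
    have : (al / (au ^ 2 * (1 + (r : ℝ) * (Ec : ℝ)) * Real.cos α)) * (Real.sin D0 / (36 * D0))
      = lam / (36 * K * au^2 * cos α^2) := by
      rw [hlam]; field_simp
    rw [this, lt_div_iff₀ (by positivity)] at hmK2
    linarith
  obtain ⟨P, hP⟩ : ∃ P, P = DΩ + 4 * N^2 * K^2 * au^2 * sin α^2 := ⟨_, rfl⟩
  have hqC : q * C1 = (3 / lam + 12 * m) * P := by
    rw [hC1eq, hP, hlam, hqK]
    field_simp
    ring
  -- coercivity
  have hcoer : ∀ t i j, 3/4 * (θ i t - θ j t)^2 ≤ E1 t := by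
    intro t i j
    have h1 : 3/8 * ∑ i, ∑ j, (θ i t - θ j t)^2 ≤ E1 t := by
      rw [hE1]
      simp only [Finset.mul_sum, ← Finset.sum_add_distrib]
      refine Finset.sum_le_sum fun i _ => Finset.sum_le_sum fun j _ => ?_
      nlinarith [sq_nonneg (2 * m * (deriv (θ i) t - deriv (θ j) t) + (θ i t - θ j t)),
        mul_nonneg (sub_nonneg.2 hmK1.le) (sq_nonneg (θ i t - θ j t))]
    by_cases hij : i = j
    · subst hij
      have : 0 ≤ ∑ i, ∑ j, (θ i t - θ j t)^2 :=
        Finset.sum_nonneg fun _ _ => Finset.sum_nonneg fun _ _ => sq_nonneg _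
      rw [sub_self]
      linarith
    · have h2 : (θ i t - θ j t)^2 + (θ j t - θ i t)^2 ≤ ∑ i, ∑ j, (θ i t - θ j t)^2 := by
        rw [← Fintype.sum_prod_type' (f := fun i j => (θ i t - θ j t)^2)]
        have := Finset.sum_le_sum_of_subset_of_nonneg
          (Finset.subset_univ ({(i,j),(j,i)} : Finset (Fin N × Fin N)))
          (f := fun p => (θ p.1 t - θ p.2 t)^2) (fun _ _ _ => sq_nonneg _)
        rwa [Finset.sum_pair (by simp [hij])] at this
      nlinarith
  have hdiam : ∀ t, E1 t < D0^2/8 → ∀ i j, |θ i t - θ j t| < D0 := by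
    intro t ht i j
    apply abs_lt_of_sq_lt_sq _ hD.le
    nlinarith [hcoer t i j, sq_nonneg (θ i t - θ j t)]
  -- derivative
  have hd1 : ∀ i t, HasDerivAt (θ i) (deriv (θ i) t) t := fun i t =>
    ((hθ i).differentiable (by norm_num) t).hasDerivAt
  have hd2 : ∀ i t, HasDerivAt (deriv (θ i)) (deriv (deriv (θ i)) t) t := by
    intro i t
    have : ContDiff ℝ 1 (deriv (θ i)) := by
      have := (contDiff_succ_iff_deriv (n := 1) (f := θ i)).1 (by simpa [one_add_one_eq_two] using hθ i)
      exact this.2.2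
    exact (this.differentiable (by norm_num) t).hasDerivAt
  obtain ⟨E', hE'⟩ : ∃ E' : ℝ → ℝ, E' = fun t => ∑ i, ∑ j,
    (2 * m * ((deriv (θ i) t - deriv (θ j) t) * (deriv (θ i) t - deriv (θ j) t)
        + (θ i t - θ j t) * (deriv (deriv (θ i)) t - deriv (deriv (θ j)) t))
      + (1 - m * q) * (2 * (θ i t - θ j t) * (deriv (θ i) t - deriv (θ j) t))
      + 2 * m^2 * (2 * (deriv (θ i) t - deriv (θ j) t) * (deriv (deriv (θ i)) t - deriv (deriv (θ j)) t))) := ⟨_, rfl⟩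
  have hE1' : ∀ t, E1 t = ∑ i, ∑ j, (2 * m * ((θ i t - θ j t) * (deriv (θ i) t - deriv (θ j) t))
      + (1 - m * q) * (θ i t - θ j t)^2 + 2 * m^2 * (deriv (θ i) t - deriv (θ j) t)^2) := by
    intro t
    rw [hE1]
    simp only [Finset.mul_sum, ← Finset.sum_add_distrib]
  have hder : ∀ t, HasDerivAt E1 (E' t) t := by
    intro t
    rw [funext hE1', hE']
    refine HasDerivAt.fun_sum fun i _ => HasDerivAt.fun_sum fun j _ => ?_
    have x1 := (hd1 i t).sub (hd1 j t)
    have x2 := (hd2 i t).sub (hd2 j t)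
    have := (((x1.mul x2).const_mul (2*m)).add ((x1.pow 2).const_mul (1 - m*q))).add
      ((x2.pow 2).const_mul (2 * m^2))
    refine this.congr_deriv ?_
    simp
  -- differential inequality
  have hineq : ∀ t ≥ (0:ℝ), E1 t < D0^2/8 → E' t + q / 2 * E1 t ≤ q * C1 := by
    intro t ht hEt
    have hdm := hdiam t hEt
    obtain ⟨x, hx⟩ : ∃ x : Fin N → ℝ, x = fun i => θ i t := ⟨_, rfl⟩
    obtain ⟨T, hT⟩ : ∃ T : Fin N → ℝ, T = fun i => ∑ l, a i l * sin (θ l t - θ i t) := ⟨_, rfl⟩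
    obtain ⟨C, hC⟩ : ∃ C : Fin N → ℝ, C = fun i => K / N * sin α * ∑ l, a i l * cos (θ l t - θ i t) := ⟨_, rfl⟩
    have hCb : ∀ i, |C i| ≤ K * au * sin α := by
      intro i
      have hsα : 0 < sin α := sin_pos_of_pos_of_lt_pi hα0 (by linarith [pi_pos])
      have h1 : |∑ l, a i l * cos (θ l t - θ i t)| ≤ N * au := by
        refine (Finset.abs_sum_le_sum_abs _ _).trans ?_
        have := Finset.sum_le_card_nsmul Finset.univ (fun l => |a i l * cos (θ l t - θ i t)|) au (by
          intro l _
          rw [abs_mul]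
          nlinarith [hau' i l, abs_cos_le_one (θ l t - θ i t), abs_nonneg (a i l), abs_nonneg (cos (θ l t - θ i t))])
        simpa using this
      rw [hC]
      dsimp only
      rw [abs_mul, abs_of_pos (by positivity : 0 < K / N * sin α)]
      calc _ ≤ K / N * sin α * (N * au) := by gcongr
        _ = _ := by field_simp
    have hCs : ∑ i, ∑ j, (C i - C j)^2 ≤ 4 * N^2 * K^2 * au^2 * sin α^2 := by
      have h1 : ∀ i j, (C i - C j)^2 ≤ 4 * (K * au * sin α)^2 := by
        intro i j
        have a1 := abs_le.1 (hCb i)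
        have a2 := abs_le.1 (hCb j)
        nlinarith
      calc _ ≤ ∑ i : Fin N, ∑ j : Fin N, 4 * (K * au * sin α)^2 :=
            Finset.sum_le_sum fun i _ => Finset.sum_le_sum fun j _ => h1 i j
        _ = _ := by simp; ring
    have hPP : ∑ i, ∑ j, ((Ω i - Ω j)^2 + (C i - C j)^2) ≤ P := by
      simp only [Finset.sum_add_distrib]
      rw [hP, hDΩ]
      simp only [sq_abs]
      linarith
    have hdT := kur_dT a hsym (fun i => θ i t)
    have hdT2 := kur_dT2 a hsym (fun i => θ i t) au hau'
    have hdiss := kur_diss a hnn G hadj hconn r hr Ec hEc al hal0 hal' D0 hD hDpi (fun i => θ i t)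
      (fun i j => (hdm i j).le)
    have hTi : ∀ i, T i = ∑ l, a i l * sin (θ l t - θ i t) := fun i => by rw [hT]
    simp only [← hTi] at hdT hdT2
    obtain ⟨X, hX⟩ : ∃ X, X = ∑ i, ∑ j, (θ i t - θ j t)^2 := ⟨_, rfl⟩
    rw [← hX] at hdT2 hdiss
    have hX0 : 0 ≤ X := by
      rw [hX]; exact Finset.sum_nonneg fun _ _ => Finset.sum_nonneg fun _ _ => sq_nonneg _
    have hode : ∀ i, m * deriv (deriv (θ i)) t = - deriv (θ i) t + Ω i + C i + K / N * cos α * T i := by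
      intro i
      have h1 := hODE i t ht
      have h2 : ∑ l, a i l * sin (θ l t - θ i t + α) = cos α * T i + sin α * ∑ l, a i l * cos (θ l t - θ i t) := by
        rw [hTi, Finset.mul_sum, Finset.mul_sum, ← Finset.sum_add_distrib]
        refine Finset.sum_congr rfl fun l _ => ?_
        rw [sin_add]; ring
      rw [h2] at h1
      rw [hC]
      linarith
    have hsum : E' t + q / 2 * E1 t ≤ ∑ i, ∑ j, (2 * ((K / N * cos α) * ((θ i t - θ j t) * (T i - T j)))
        + 12 * m * ((K / N * cos α)^2 * (T i - T j)^2) + (2 * lam / 3 + q / 2) * (θ i t - θ j t)^2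
        + (3 / lam + 12 * m) * ((Ω i - Ω j)^2 + (C i - C j)^2)) := by
      rw [hE', hE1']
      simp only [Finset.mul_sum, ← Finset.sum_add_distrib]
      refine Finset.sum_le_sum fun i _ => Finset.sum_le_sum fun j _ => ?_
      have := kur_pt m q lam (θ i t - θ j t) (deriv (θ i) t - deriv (θ j) t)
        (deriv (deriv (θ i)) t - deriv (deriv (θ j)) t) (Ω i - Ω j) (C i - C j)
        (K / N * cos α * (T i - T j)) hm hq0 hmK1 hlam0 (by rw [mul_sub, hode, hode]; ring)
      refine this.trans (le_of_eq ?_)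
      ring
    simp only [Finset.sum_add_distrib, ← Finset.mul_sum] at hsum hPP
    rw [hdT, ← hX] at hsum
    have k1 : 2 * (K / N * cos α * -(N * ∑ i, ∑ l, a i l * ((θ i t - θ l t) * sin (θ i t - θ l t)))) ≤ -(2 * lam * X) := by
      have : K / N * cos α * -(N * ∑ i, ∑ l, a i l * ((θ i t - θ l t) * sin (θ i t - θ l t)))
        = - (K * cos α * ∑ i, ∑ l, a i l * ((θ i t - θ l t) * sin (θ i t - θ l t))) := by
        field_simp
      rw [this, hlam]
      have := mul_le_mul_of_nonneg_left hdiss (by positivity : 0 ≤ K * cos α)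
      linarith
    have k2 : 12 * m * ((K / N * cos α)^2 * ∑ i, ∑ j, (T i - T j)^2) ≤ 2 * lam / 3 * X := by
      calc _ ≤ 12 * m * ((K / N * cos α)^2 * (2 * N^2 * au^2 * X)) := by gcongr
        _ = 2/3 * ((36 * m * K^2 * au^2 * cos α^2) * X) := by field_simp; ring
        _ ≤ 2/3 * (lam * X) := by gcongr
        _ = _ := by ring
    have k3 : (3 / lam + 12 * m) * (∑ i, ∑ j, (Ω i - Ω j)^2 + ∑ i, ∑ j, (C i - C j)^2) ≤ q * C1 := by
      rw [hqC]
      gcongr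
    have k4 : q * X ≤ lam * X := by gcongr
    nlinarith [mul_nonneg hlam0.le hX0]
  -- barrier
  intro t ht
  suffices hs : E1 t < D0^2/8 from ⟨hs, hdiam t hs⟩
  obtain ⟨c, hc⟩ : ∃ c, c = max (E1 0) ((D0^2/8 + 2 * C1)/2) := ⟨_, rfl⟩
  have hcl : c < D0^2/8 := by rw [hc]; exact max_lt hinit (by linarith)
  have hc2 : 2 * C1 < c := by rw [hc]; exact lt_of_lt_of_le (by linarith) (le_max_right _ _)
  refine lt_of_le_of_lt ?_ hcl
  refine image_le_of_deriv_right_lt_deriv_boundary (f := E1) (f' := E') (a := 0) (b := t)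
    (B := fun _ => c) (B' := fun _ => 0) (fun s _ => (hder s).continuousAt.continuousWithinAt)
    (fun s _ => (hder s).hasDerivWithinAt) (by rw [hc]; exact le_max_left _ _)
    (fun s => hasDerivAt_const s c) ?_ (Set.right_mem_Icc.2 ht)
  intro s hs hsc
  have := hineq s hs.1 (by rw [hsc]; exact hcl)
  rw [hsc] at this
  nlinarith
end

section
/- Let G = (V, E, A) be a symmetric connected graph on V = {1,...,N} and θ : [0,∞) → ℝ^N a twice continuously differentiable solution of m θ_i'' + θ_i' = Ω_i + (K/N) Σ_{l=1}^N a_{il} sin(θ_l − θ_i + α) with ω_i = θ_i'. Assume: E₁(0) < D₀²/8, D^∞ ∈ (0, π/2), D₀ ∈ (0, π), D^∞ < D₀; √K > ((1+r|E^c|)/(a_l cos α)) · max{D₀/sin D₀, 1/cos D^∞}; m√K < 1/8; mK < (a_l/(a_u²(1+r|E^c|) cos α)) · min{sin D₀/(36 D₀), cos D^∞/24}; and C₁ < (D^∞)²/16. Then there exists a finite time t_* ≥ 0 such that the phase diameter satisfies D(θ(t)) = max_{1≤i,j≤N}|θ_i(t) − θ_j(t)| ≤ D^∞ for all t ≥ t_*.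 -/
open Finset Real

lemma pde_sin_bound (D x : ℝ) (hD : 0 < D) (hpi : D < Real.pi) (hx : |x| ≤ D) :
    (Real.sin D / D) * x ^ 2 ≤ x * Real.sin x := by
  have key : ∀ y : ℝ, 0 ≤ y → y ≤ D → (Real.sin D / D) * y ^ 2 ≤ y * Real.sin y := by
    intro y h0 h1
    have hb : 0 ≤ 1 - y / D := by rw [sub_nonneg, div_le_one hD]; exact h1
    have ha : 0 ≤ y / D := by positivity
    have hDm : D ∈ Set.Icc 0 Real.pi := ⟨hD.le, hpi.le⟩
    have h0m : (0 : ℝ) ∈ Set.Icc 0 Real.pi := ⟨le_refl _, Real.pi_pos.le⟩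
    have hc := strictConcaveOn_sin_Icc.concaveOn.2 hDm h0m ha hb (by ring)
    simp only [smul_eq_mul, Real.sin_zero, mul_zero, add_zero] at hc
    rw [div_mul_cancel₀ _ hD.ne'] at hc
    calc (Real.sin D / D) * y ^ 2 = y * (y / D * Real.sin D) := by ring
      _ ≤ y * Real.sin y := mul_le_mul_of_nonneg_left hc h0
  rcases le_total 0 x with h | h
  · exact key x h (le_of_abs_le hx)
  · have := key (-x) (by linarith) (by linarith [neg_le_of_abs_le hx])
    rw [Real.sin_neg] at this
    nlinarith

lemma pde_walk {V : Type*} (G : SimpleGraph V) (x : V → ℝ) {u v : V} (p : G.Walk u v) :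
    (x u - x v) ^ 2 ≤ p.length * (p.darts.map (fun d => (x d.fst - x d.snd) ^ 2)).sum := by
  induction p with
  | nil => simp
  | @cons u v w h p ih =>
    simp only [SimpleGraph.Walk.length_cons, SimpleGraph.Walk.darts_cons, List.map_cons,
      List.sum_cons]
    set S := (p.darts.map (fun d => (x d.fst - x d.snd) ^ 2)).sum with hS
    have hS0 : 0 ≤ S := by
      apply List.sum_nonneg
      intro y hy
      simp only [List.mem_map] at hy
      obtain ⟨d, _, rfl⟩ := hy
      positivity
    push_cast
    set n : ℝ := (p.length : ℝ) with hn
    have hn0 : 0 ≤ n := Nat.cast_nonneg _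
    set b := x u - x v
    set c := x v - x w
    have : x u - x w = b + c := by simp only [b, c]; ring
    rw [this]
    rcases hn0.eq_or_lt with h0 | hpos
    · rw [← h0] at ih ⊢
      have : c = 0 := by nlinarith
      rw [this]; nlinarith
    · have h2 : 2 * b * c ≤ n * b ^ 2 + c ^ 2 / n := by
        have : 0 ≤ (n * b - c) ^ 2 / n := by positivity
        have e : (n * b - c) ^ 2 / n = n * b ^ 2 - 2 * b * c + c ^ 2 / n := by
          field_simp; ring
        linarith
      have h3 : c ^ 2 / n ≤ S := by rw [div_le_iff₀ hpos]; linarith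
      nlinarith

lemma pde_conn (N : ℕ) (a : Fin N → Fin N → ℝ) (G : SimpleGraph (Fin N))
    (hadj : ∀ i j, G.Adj i j ↔ i ≠ j ∧ 0 < a i j) (hconn : G.Connected) (r : ℕ)
    (hr : r = Finset.univ.sup (fun p : Fin N × Fin N => G.dist p.1 p.2))
    (Ec : ℕ) (hEc : Ec = (Finset.filter
      (fun p : Fin N × Fin N => ¬ 0 < a p.1 p.2) Finset.univ).card) (x : Fin N → ℝ) :
    ∑ p : Fin N × Fin N, (x p.1 - x p.2) ^ 2 ≤ (1 + (r : ℝ) * Ec) *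
      ∑ p ∈ Finset.univ.filter (fun p : Fin N × Fin N => 0 < a p.1 p.2),
        (x p.1 - x p.2) ^ 2 := by
  set S := ∑ p ∈ Finset.univ.filter (fun p : Fin N × Fin N => 0 < a p.1 p.2),
        (x p.1 - x p.2) ^ 2 with hS
  have hS0 : 0 ≤ S := Finset.sum_nonneg (fun _ _ => sq_nonneg _)
  have key : ∀ i j, (x i - x j) ^ 2 ≤ r * S := by
    intro i j
    obtain ⟨p, hp, hl⟩ := hconn.exists_path_of_dist i j
    have h1 := pde_walk G x p
    have hlen : (p.length : ℝ) ≤ r := by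
      rw [hl, hr]
      exact_mod_cast Finset.le_sup (f := fun p : Fin N × Fin N => G.dist p.1 p.2)
        (Finset.mem_univ (i, j))
    have hnd : p.darts.Nodup := SimpleGraph.Walk.darts_nodup_of_support_nodup hp.support_nodup
    have hnd' : (p.darts.map (fun d => d.toProd)).Nodup :=
      hnd.map (fun d e h => SimpleGraph.Dart.ext _ _ h)
    have h2 : (p.darts.map (fun d => (x d.fst - x d.snd) ^ 2)).sum ≤ S := by
      have e : p.darts.map (fun d => (x d.fst - x d.snd) ^ 2)
        = (p.darts.map (fun d => d.toProd)).map (fun q => (x q.1 - x q.2) ^ 2) := by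
        rw [List.map_map]; rfl
      rw [e, ← List.sum_toFinset _ hnd']
      apply Finset.sum_le_sum_of_subset_of_nonneg
      · intro q hq
        simp only [List.mem_toFinset, List.mem_map] at hq
        obtain ⟨d, _, rfl⟩ := hq
        simp only [Finset.mem_filter, Finset.mem_univ, true_and]
        exact ((hadj _ _).1 d.adj).2
      · intros; positivity
    calc _ ≤ _ := h1
      _ ≤ p.length * S := mul_le_mul_of_nonneg_left h2 (Nat.cast_nonneg _)
      _ ≤ r * S := mul_le_mul_of_nonneg_right hlen hS0
  rw [← Finset.sum_filter_add_sum_filter_not Finset.univ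
    (fun p : Fin N × Fin N => 0 < a p.1 p.2), ← hS]
  have : ∑ p ∈ Finset.univ.filter (fun p : Fin N × Fin N => ¬ 0 < a p.1 p.2),
        (x p.1 - x p.2) ^ 2 ≤ Ec * (r * S) := by
    rw [hEc, ← nsmul_eq_mul]
    exact Finset.sum_le_card_nsmul _ _ _ (fun q _ => key _ _)
  linarith

lemma pde_young {ι : Type*} [Fintype ι] (e : ℝ) (he : 0 < e) (p q : ι → ι → ℝ) :
    2 * ∑ i, ∑ j, p i j * q i j ≤ e * ∑ i, ∑ j, p i j ^ 2 + 1 / e * ∑ i, ∑ j, q i j ^ 2 := by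
  simp only [Finset.mul_sum, ← Finset.sum_add_distrib]
  refine Finset.sum_le_sum fun i _ => Finset.sum_le_sum fun j _ => ?_
  have : 0 ≤ (e * p i j - q i j) ^ 2 / e := by positivity
  have h : (e * p i j - q i j) ^ 2 / e
    = e * p i j ^ 2 - 2 * (p i j * q i j) + 1 / e * q i j ^ 2 := by
    field_simp; ring
  linarith

lemma pde_prod {N : ℕ} (p q : Fin N → ℝ) :
    ∑ i, ∑ j, (p i - p j) * (q i - q j)
      = 2 * N * ∑ i, p i * q i - 2 * (∑ i, p i) * ∑ i, q i := by
  have : ∀ i j, (p i - p j) * (q i - q j) = p i * q i - p i * q j - p j * q i + p j * q j := by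
    intros; ring
  simp only [this, Finset.sum_add_distrib, Finset.sum_sub_distrib, Finset.sum_const,
    Finset.card_univ, Fintype.card_fin, nsmul_eq_mul, ← Finset.mul_sum, ← Finset.sum_mul]
  ring

lemma pde_XS {N : ℕ} (a : Fin N → Fin N → ℝ) (hsym : ∀ i j, a i j = a j i) (x : Fin N → ℝ) :
    (∑ i, ∑ l, a i l * Real.sin (x l - x i) = 0) ∧
    ∑ i, ∑ j, (x i - x j) * ((∑ l, a i l * Real.sin (x l - x i))
        - ∑ l, a j l * Real.sin (x l - x j))
      = - (N * ∑ i, ∑ j, a i j * ((x i - x j) * Real.sin (x i - x j))) := by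
  have anti : ∀ i l, a i l * Real.sin (x l - x i) = - (a l i * Real.sin (x i - x l)) := by
    intro i l
    rw [hsym i l, ← neg_sub (x i) (x l), Real.sin_neg]; ring
  have h0 : ∑ i, ∑ l, a i l * Real.sin (x l - x i) = 0 := by
    have h1 : ∑ i, ∑ l, a i l * Real.sin (x l - x i)
      = - ∑ i, ∑ l, a i l * Real.sin (x l - x i) := by
      conv_lhs => rw [Finset.sum_comm]
      simp only [← Finset.sum_neg_distrib]
      exact Finset.sum_congr rfl fun i _ => Finset.sum_congr rfl fun l _ => anti l i
    linarith
  refine ⟨h0, ?_⟩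
  rw [pde_prod x (fun i => ∑ l, a i l * Real.sin (x l - x i)), h0]
  have h2 : ∑ i, x i * ∑ l, a i l * Real.sin (x l - x i)
      = - ∑ i, ∑ l, x l * (a i l * Real.sin (x l - x i)) := by
    simp only [Finset.mul_sum, ← Finset.sum_neg_distrib]
    rw [Finset.sum_comm]
    refine Finset.sum_congr rfl fun i _ => Finset.sum_congr rfl fun l _ => ?_
    rw [anti l i]; ring
  have h3 : ∑ i, ∑ j, a i j * ((x i - x j) * Real.sin (x i - x j))
      = - ∑ i, x i * (∑ l, a i l * Real.sin (x l - x i))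
        + ∑ i, ∑ l, x l * (a i l * Real.sin (x l - x i)) := by
    simp only [Finset.mul_sum, ← Finset.sum_neg_distrib, ← Finset.sum_add_distrib]
    refine Finset.sum_congr rfl fun i _ => Finset.sum_congr rfl fun l _ => ?_
    rw [← neg_sub (x i) (x l), Real.sin_neg]; ring
  rw [h3]
  linear_combination (N : ℝ) * h2

lemma pde_SS {N : ℕ} (a : Fin N → Fin N → ℝ) (hsym : ∀ i j, a i j = a j i)
    (hnn : ∀ i j, 0 ≤ a i j) (au : ℝ) (hau : ∀ i j, a i j ≤ au) (x : Fin N → ℝ) :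
    ∑ i, ∑ j, ((∑ l, a i l * Real.sin (x l - x i))
        - ∑ l, a j l * Real.sin (x l - x j)) ^ 2
      ≤ 2 * N ^ 2 * au ^ 2 * ∑ i, ∑ j, (x i - x j) ^ 2 := by
  have h := pde_prod (fun i => ∑ l, a i l * Real.sin (x l - x i))
    (fun i => ∑ l, a i l * Real.sin (x l - x i))
  simp only [(pde_XS a hsym x).1, mul_zero, sub_zero] at h
  simp only [pow_two] at h ⊢
  rw [h]
  simp only [← pow_two]
  have h1 : ∀ i, (∑ l, a i l * Real.sin (x l - x i)) ^ 2 ≤ N * (au ^ 2 * ∑ j, (x i - x j) ^ 2) := by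
    intro i
    have := sq_sum_le_card_mul_sum_sq (s := Finset.univ) (f := fun l => a i l * Real.sin (x l - x i))
    simp only [Finset.card_univ, Fintype.card_fin] at this
    refine this.trans (mul_le_mul_of_nonneg_left ?_ (Nat.cast_nonneg _))
    rw [Finset.mul_sum]
    refine Finset.sum_le_sum fun l _ => ?_
    rw [mul_pow]
    have s1 : Real.sin (x l - x i) ^ 2 ≤ (x i - x l) ^ 2 := by
      rw [← neg_sub (x l) (x i), neg_sq]
      exact sq_le_sq.2 Real.abs_sin_le_abs
    exact mul_le_mul (pow_le_pow_left₀ (hnn _ _) (hau _ _) 2) s1 (sq_nonneg _) (sq_nonneg _)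
  calc _ ≤ 2 * (N : ℝ) * ∑ i, N * (au ^ 2 * ∑ j, (x i - x j) ^ 2) :=
        mul_le_mul_of_nonneg_left (Finset.sum_le_sum fun i _ => h1 i) (by positivity)
    _ = _ := by simp only [← Finset.mul_sum]; ring

lemma pde_CC {N : ℕ} (a : Fin N → Fin N → ℝ)
    (hnn : ∀ i j, 0 ≤ a i j) (au : ℝ) (hau : ∀ i j, a i j ≤ au) (x : Fin N → ℝ) :
    ∑ i, ∑ j, ((∑ l, a i l * Real.cos (x l - x i))
        - ∑ l, a j l * Real.cos (x l - x j)) ^ 2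
      ≤ 4 * N ^ 4 * au ^ 2 := by
  have h1 : ∀ i, |∑ l, a i l * Real.cos (x l - x i)| ≤ N * au := by
    intro i
    refine (Finset.abs_sum_le_sum_abs _ _).trans ?_
    have : ∑ l : Fin N, |a i l * Real.cos (x l - x i)| ≤ ∑ l : Fin N, au := by
      refine Finset.sum_le_sum fun l _ => ?_
      rw [abs_mul, abs_of_nonneg (hnn i l)]
      exact (mul_le_of_le_one_right (hnn i l) (Real.abs_cos_le_one _)).trans (hau i l)
    simpa using this
  calc _ ≤ ∑ i : Fin N, ∑ j : Fin N, (2 * (N * au)) ^ 2 := by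
        refine Finset.sum_le_sum fun i _ => Finset.sum_le_sum fun j _ => ?_
        refine sq_le_sq' ?_ ?_ <;>
        linarith [abs_le.1 (h1 i), abs_le.1 (h1 j), (abs_le.1 (h1 i)).1, (abs_le.1 (h1 j)).1,
          (abs_le.1 (h1 i)).2, (abs_le.1 (h1 j)).2]
    _ = _ := by simp; ring

/-- scalar bookkeeping -/
lemma pde_scalar (m κ K L cα sα au n X Z XO XC WO WS WC S DO SS CC C1 : ℝ)
    (hm : 0 < m) (hκ : 0 < κ) (hK : K = κ ^ 2) (hn : 0 < n) (hL : 0 < L) (hX : 0 ≤ X) (hZ : 0 ≤ Z)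
    (hκL : 1 < κ * L) (hmκ : m * κ < 1 / 8)
    (hmK : m * K * (cα ^ 2 * au ^ 2) ≤ L / 36)
    (hS : L * X ≤ cα * S)
    (hSS : SS ≤ 2 * n ^ 2 * au ^ 2 * X) (hCC : CC ≤ 4 * n ^ 4 * au ^ 2)
    (h1 : 2 * XO ≤ (K * L / 3) * X + 1 / (K * L / 3) * DO)
    (h2 : 2 * (K * sα / n * XC) ≤ (K * L / 3) * X + 1 / (K * L / 3) * ((K * sα / n) ^ 2 * CC))
    (h3 : 2 * WO ≤ (1 / 6) * Z + 1 / (1 / 6) * DO)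
    (h4 : 2 * (K * sα / n * WC) ≤ (1 / 6) * Z + 1 / (1 / 6) * ((K * sα / n) ^ 2 * CC))
    (h5 : 2 * (K * cα / n * WS) ≤ (1 / 2) * Z + 1 / (1 / 2) * ((K * cα / n) ^ 2 * SS))
    (hC1 : κ * C1 = 3 / (K * L) * DO + 12 * m * DO
      + 12 * n ^ 2 * K * au ^ 2 * sα ^ 2 * (1 / L + 4 * m * K)) :
    -2 * m * (1 - m * κ) * Z + κ * (1 - m * κ) * X
      + 2 * (XO + K * cα / n * (-(n * S)) + K * sα / n * XC)
      + 4 * m * (WO + K * cα / n * WS + K * sα / n * WC) ≤ κ * C1 := by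
  have hKp : 0 < K := by rw [hK]; positivity
  have e1 : K * cα / n * (-(n * S)) = - (K * (cα * S)) := by field_simp
  have b1 : K * (L * X) ≤ K * (cα * S) := mul_le_mul_of_nonneg_left hS hKp.le
  have b2 : κ * X ≤ K * (L * X) := by
    have : κ * X * 1 ≤ κ * X * (κ * L) := mul_le_mul_of_nonneg_left hκL.le (by positivity)
    rw [hK]; linarith
  have b3 : 0 ≤ m * κ * (κ * X) := by positivity
  have e2 : 1 / (K * L / 3) * DO = 3 / (K * L) * DO := by field_simp
  have c1 : (K * sα / n) ^ 2 * CC ≤ 4 * n ^ 2 * K ^ 2 * sα ^ 2 * au ^ 2 := by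
    calc _ ≤ (K * sα / n) ^ 2 * (4 * n ^ 4 * au ^ 2) := mul_le_mul_of_nonneg_left hCC (sq_nonneg _)
      _ = _ := by field_simp
  have c2 : 1 / (K * L / 3) * ((K * sα / n) ^ 2 * CC) ≤ 12 * n ^ 2 * K * au ^ 2 * sα ^ 2 * (1 / L) := by
    calc _ ≤ 1 / (K * L / 3) * (4 * n ^ 2 * K ^ 2 * sα ^ 2 * au ^ 2) :=
          mul_le_mul_of_nonneg_left c1 (by positivity)
      _ = _ := by field_simp; ring
  have c3 : (K * cα / n) ^ 2 * SS ≤ 2 * K ^ 2 * cα ^ 2 * au ^ 2 * X := by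
    calc _ ≤ (K * cα / n) ^ 2 * (2 * n ^ 2 * au ^ 2 * X) :=
          mul_le_mul_of_nonneg_left hSS (sq_nonneg _)
      _ = _ := by field_simp
  have c4 : m * (2 * K ^ 2 * cα ^ 2 * au ^ 2 * X) ≤ K * L / 18 * X := by
    have := mul_le_mul_of_nonneg_left hmK (by positivity : 0 ≤ 2 * K * X)
    linarith
  have d3 := mul_le_mul_of_nonneg_left h3 hm.le
  have d4 := mul_le_mul_of_nonneg_left h4 hm.le
  have d5 := mul_le_mul_of_nonneg_left h5 hm.le
  have dc1 := mul_le_mul_of_nonneg_left c1 hm.le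
  have dc3 := mul_le_mul_of_nonneg_left c3 hm.le
  have z1 : m * κ * (m * Z) ≤ 1 / 8 * (m * Z) := mul_le_mul_of_nonneg_right hmκ.le (by positivity)
  have z2 : 0 ≤ m * Z := by positivity
  have z3 : 0 ≤ K * L * X := by positivity
  rw [e1, hC1]
  norm_num at d3 d4 d5
  linarith

lemma pde_core {N : ℕ} (hN : 0 < N) (a : Fin N → Fin N → ℝ) (hsym : ∀ i j, a i j = a j i)
    (hnn : ∀ i j, 0 ≤ a i j) (au : ℝ) (hau : ∀ i j, a i j ≤ au)
    (m κ K L α C1 : ℝ) (Ω x w F : Fin N → ℝ)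
    (hm : 0 < m) (hκ : 0 < κ) (hK : K = κ ^ 2) (hL : 0 < L)
    (hκL : 1 < κ * L) (hmκ : m * κ < 1 / 8)
    (hmK : m * K * (Real.cos α ^ 2 * au ^ 2) ≤ L / 36)
    (hS : L * ∑ i, ∑ j, (x i - x j) ^ 2
      ≤ Real.cos α * ∑ i, ∑ j, a i j * ((x i - x j) * Real.sin (x i - x j)))
    (hF : ∀ i, F i = Ω i + (K / (N : ℝ)) * ∑ l, a i l * Real.sin (x l - x i + α))
    (hC1 : κ * C1 = 3 / (K * L) * (∑ i, ∑ j, (Ω i - Ω j) ^ 2)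
      + 12 * m * (∑ i, ∑ j, (Ω i - Ω j) ^ 2)
      + 12 * (N : ℝ) ^ 2 * K * au ^ 2 * Real.sin α ^ 2 * (1 / L + 4 * m * K)) :
    -2 * m * (1 - m * κ) * (∑ i, ∑ j, (w i - w j) ^ 2)
      + κ * (1 - m * κ) * (∑ i, ∑ j, (x i - x j) ^ 2)
      + 2 * (∑ i, ∑ j, (x i - x j) * (F i - F j))
      + 4 * m * (∑ i, ∑ j, (w i - w j) * (F i - F j)) ≤ κ * C1 := by
  have hn : (0 : ℝ) < N := by exact_mod_cast hN
  have hKp : 0 < K := by rw [hK]; positivity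
  set s : Fin N → ℝ := fun i => ∑ l, a i l * Real.sin (x l - x i) with hs
  set c : Fin N → ℝ := fun i => ∑ l, a i l * Real.cos (x l - x i) with hc
  have hF' : ∀ i, F i = Ω i + K * Real.cos α / N * s i + K * Real.sin α / N * c i := by
    intro i
    rw [hF]
    have : ∑ l, a i l * Real.sin (x l - x i + α) = Real.cos α * s i + Real.sin α * c i := by
      simp only [hs, hc, Finset.mul_sum, ← Finset.sum_add_distrib]
      refine Finset.sum_congr rfl fun l _ => ?_
      rw [Real.sin_add]; ring
    rw [this]; ring
  have split : ∀ p : Fin N → ℝ, ∑ i, ∑ j, (p i - p j) * (F i - F j)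
      = ∑ i, ∑ j, (p i - p j) * (Ω i - Ω j)
        + K * Real.cos α / N * ∑ i, ∑ j, (p i - p j) * (s i - s j)
        + K * Real.sin α / N * ∑ i, ∑ j, (p i - p j) * (c i - c j) := by
    intro p
    simp only [Finset.mul_sum, ← Finset.sum_add_distrib]
    refine Finset.sum_congr rfl fun i _ => Finset.sum_congr rfl fun j _ => ?_
    rw [hF', hF']; ring
  have young' : ∀ (e k : ℝ), 0 < e → ∀ p q : Fin N → ℝ,
      2 * (k * ∑ i, ∑ j, (p i - p j) * (q i - q j))
        ≤ e * ∑ i, ∑ j, (p i - p j) ^ 2 + 1 / e * (k ^ 2 * ∑ i, ∑ j, (q i - q j) ^ 2) := by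
    intro e k he p q
    have h := pde_young e he (fun i j => p i - p j) (fun i j => k * (q i - q j))
    have e1 : ∑ i, ∑ j, (p i - p j) * (k * (q i - q j))
      = k * ∑ i, ∑ j, (p i - p j) * (q i - q j) := by
      simp only [Finset.mul_sum]
      refine Finset.sum_congr rfl fun i _ => Finset.sum_congr rfl fun j _ => ?_
      ring
    have e2 : ∑ i, ∑ j, (k * (q i - q j)) ^ 2 = k ^ 2 * ∑ i, ∑ j, (q i - q j) ^ 2 := by
      simp only [Finset.mul_sum, mul_pow]
    simp only [e1, e2] at h
    exact h
  rw [split x, split w]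
  have hXS : ∑ i, ∑ j, (x i - x j) * (s i - s j) = _ := (pde_XS a hsym x).2
  rw [hXS]
  have h1 := young' (K * L / 3) 1 (by positivity) x Ω
  have h3 := young' (1 / 6) 1 (by norm_num) w Ω
  rw [one_mul, one_pow, one_mul] at h1 h3
  exact pde_scalar m κ K L (Real.cos α) (Real.sin α) au N _ _ _ _ _ _ _ _ _ _ _ C1
    hm hκ hK hn hL (Finset.sum_nonneg fun _ _ => Finset.sum_nonneg fun _ _ => sq_nonneg _)
    (Finset.sum_nonneg fun _ _ => Finset.sum_nonneg fun _ _ => sq_nonneg _) hκL hmκ hmK hS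
    (pde_SS a hsym hnn au hau x) (pde_CC a hnn au hau x) h1
    (young' _ _ (by positivity) x c) h3 (young' _ _ (by norm_num) w c)
    (young' _ _ (by norm_num) w s) hC1

lemma pde_coercive {N : ℕ} (m κ : ℝ) (hmκ : m * κ < 1 / 8) (x w : Fin N → ℝ) (i j : Fin N) :
    (x i - x j) ^ 2 ≤ 2 * (2 * m * (∑ i, ∑ j, (x i - x j) * (w i - w j))
        + (1 - m * κ) * (∑ i, ∑ j, (x i - x j) ^ 2)
        + 2 * m ^ 2 * (∑ i, ∑ j, (w i - w j) ^ 2)) * (4 / 3) := by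
  have h1 : (x i - x j) ^ 2 ≤ ∑ i, ∑ j, (x i - x j) ^ 2 :=
    (Finset.single_le_sum (f := fun j => (x i - x j) ^ 2) (fun _ _ => sq_nonneg _)
      (Finset.mem_univ j)).trans
    (Finset.single_le_sum (f := fun i => ∑ j, (x i - x j) ^ 2)
      (fun _ _ => Finset.sum_nonneg fun _ _ => sq_nonneg _) (Finset.mem_univ i))
  have h2 : 0 ≤ 2 * m * (∑ i, ∑ j, (x i - x j) * (w i - w j))
        + (1 / 2) * (∑ i, ∑ j, (x i - x j) ^ 2)
        + 2 * m ^ 2 * (∑ i, ∑ j, (w i - w j) ^ 2) := by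
    simp only [Finset.mul_sum, ← Finset.sum_add_distrib]
    refine Finset.sum_nonneg fun i _ => Finset.sum_nonneg fun j _ => ?_
    nlinarith [sq_nonneg ((x i - x j) + 2 * m * (w i - w j))]
  have h3 : 0 ≤ ∑ i, ∑ j, (x i - x j) ^ 2 :=
    Finset.sum_nonneg fun _ _ => Finset.sum_nonneg fun _ _ => sq_nonneg _
  nlinarith

lemma pde_deriv {N : ℕ} (m κ : ℝ) (θ : Fin N → ℝ → ℝ) (hθ : ∀ i, ContDiff ℝ 2 (θ i))
    (F : Fin N → ℝ) (E1 : ℝ → ℝ)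
    (hE1 : ∀ t, E1 t
      = 2 * m * (∑ i, ∑ j, (θ i t - θ j t) * (deriv (θ i) t - deriv (θ j) t))
        + (1 - m * κ) * (∑ i, ∑ j, (θ i t - θ j t) ^ 2)
        + 2 * m ^ 2 * (∑ i, ∑ j, (deriv (θ i) t - deriv (θ j) t) ^ 2)) (t : ℝ) :
    HasDerivAt E1 (deriv E1 t) t ∧
    ((∀ i, m * deriv (deriv (θ i)) t + deriv (θ i) t = F i) →
    deriv E1 t = - κ * E1 t + (-2 * m * (1 - m * κ) * (∑ i, ∑ j, (deriv (θ i) t - deriv (θ j) t) ^ 2)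
      + κ * (1 - m * κ) * (∑ i, ∑ j, (θ i t - θ j t) ^ 2)
      + 2 * (∑ i, ∑ j, (θ i t - θ j t) * (F i - F j))
      + 4 * m * (∑ i, ∑ j, (deriv (θ i) t - deriv (θ j) t) * (F i - F j)))) := by
  have d1 : ∀ i, HasDerivAt (θ i) (deriv (θ i) t) t := fun i =>
    ((hθ i).differentiable (by norm_num) t).hasDerivAt
  have d2 : ∀ i, HasDerivAt (deriv (θ i)) (deriv (deriv (θ i)) t) t := fun i => by
    have h : ContDiff ℝ 1 (deriv (θ i)) := by
      have := hθ i
      rw [show (2 : WithTop ℕ∞) = 1 + 1 by norm_num, contDiff_succ_iff_deriv] at this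
      exact this.2.2
    exact (h.differentiable (by norm_num) t).hasDerivAt
  have hfun : E1 = fun t => ∑ i, ∑ j, (2 * m * ((θ i t - θ j t) * (deriv (θ i) t - deriv (θ j) t))
        + (1 - m * κ) * (θ i t - θ j t) ^ 2
        + 2 * m ^ 2 * (deriv (θ i) t - deriv (θ j) t) ^ 2) := by
    funext t
    rw [hE1]
    simp only [Finset.mul_sum, ← Finset.sum_add_distrib]
  have hD : HasDerivAt E1 (∑ i, ∑ j, (2 * m * ((deriv (θ i) t - deriv (θ j) t) *
        (deriv (θ i) t - deriv (θ j) t)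
          + (θ i t - θ j t) * (deriv (deriv (θ i)) t - deriv (deriv (θ j)) t))
        + (1 - m * κ) * (2 * (θ i t - θ j t) * (deriv (θ i) t - deriv (θ j) t))
        + 2 * m ^ 2 * (2 * (deriv (θ i) t - deriv (θ j) t) *
          (deriv (deriv (θ i)) t - deriv (deriv (θ j)) t)))) t := by
    rw [hfun]
    refine HasDerivAt.fun_sum fun i _ => HasDerivAt.fun_sum fun j _ => ?_
    have a1 := (d1 i).sub (d1 j)
    have a2 := (d2 i).sub (d2 j)
    have b := (((a1.mul a2).const_mul (2 * m)).add ((a1.pow 2).const_mul (1 - m * κ))).add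
      ((a2.pow 2).const_mul (2 * m ^ 2))
    convert b using 1
    · rfl
    · simp [Pi.sub_apply]
  refine ⟨hD.differentiableAt.hasDerivAt, fun hF => ?_⟩
  rw [hD.deriv, hE1]
  simp only [Finset.mul_sum, ← Finset.sum_add_distrib]
  refine Finset.sum_congr rfl fun i _ => Finset.sum_congr rfl fun j _ => ?_
  rw [← hF i, ← hF j]
  ring

lemma pde_lim (κ M : ℝ) (hκ : 0 < κ) :
    Filter.Tendsto (fun t : ℝ => M * Real.exp (-κ * t)) Filter.atTop (nhds 0) := by
  have h1 : Filter.Tendsto (fun t : ℝ => -κ * t) Filter.atTop Filter.atBot :=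
    Filter.tendsto_id.const_mul_atTop_of_neg (by linarith)
  simpa using (Real.tendsto_exp_atBot.comp h1).const_mul M

set_option maxHeartbeats 1000000 in
/-- entrance of the phase diameter into a small region after a finite time. -/
theorem phase_diameter_entrance
    (N : ℕ) (hN : 0 < N)
    (a : Fin N → Fin N → ℝ)
    (hsym : ∀ i j, a i j = a j i)
    (hnn : ∀ i j, 0 ≤ a i j)
    (G : SimpleGraph (Fin N))
    (hadj : ∀ i j, G.Adj i j ↔ i ≠ j ∧ 0 < a i j)
    (hconn : G.Connected)
    (hEne : (Finset.filter (fun p : Fin N × Fin N => 0 < a p.1 p.2) Finset.univ).Nonempty)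
    (r : ℕ)
    (hr : r = Finset.univ.sup (fun p : Fin N × Fin N => G.dist p.1 p.2))
    (Ec : ℕ)
    (hEc : Ec = (Finset.filter
      (fun p : Fin N × Fin N => ¬ 0 < a p.1 p.2) Finset.univ).card)
    (al : ℝ)
    (hal : al = (Finset.filter (fun p : Fin N × Fin N => 0 < a p.1 p.2) Finset.univ).inf' hEne (fun p => a p.1 p.2))
    (au : ℝ)
    (hau : au = (Finset.filter (fun p : Fin N × Fin N => 0 < a p.1 p.2) Finset.univ).sup' hEne (fun p => a p.1 p.2))
    (m K α D0 : ℝ) (hm : 0 < m) (hK : 0 < K) (hα : 0 < α ∧ α < Real.pi / 2)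
    (hD0 : 0 < D0 ∧ D0 < Real.pi)
    (Ω : Fin N → ℝ)
    (θ : Fin N → ℝ → ℝ)
    (hθ : ∀ i, ContDiff ℝ 2 (θ i))
    (hODE : ∀ i, ∀ t ≥ (0 : ℝ),
      m * deriv (deriv (θ i)) t + deriv (θ i) t
        = Ω i + (K / (N : ℝ)) * ∑ l, a i l * Real.sin (θ l t - θ i t + α))
    (DΩ : ℝ) (hDΩ : DΩ = ∑ i, ∑ j, |Ω i - Ω j| ^ 2)
    (E1 : ℝ → ℝ)
    (hE1 : ∀ t, E1 t
      = 2 * m * (∑ i, ∑ j, (θ i t - θ j t) * (deriv (θ i) t - deriv (θ j) t))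
        + (1 - m * Real.sqrt K) * (∑ i, ∑ j, (θ i t - θ j t) ^ 2)
        + 2 * m ^ 2 * (∑ i, ∑ j, (deriv (θ i) t - deriv (θ j) t) ^ 2))
    (C1 : ℝ)
    (hC1 : C1
      = (3 * (1 + (Ec : ℝ) * (r : ℝ)) * D0 / (K * Real.sqrt K * al * Real.cos α * Real.sin D0)
          + 12 * m / Real.sqrt K) * DΩ
        + 12 * (N : ℝ) ^ 2 * Real.sqrt K * au ^ 2 * Real.sin α ^ 2
          * ((1 + (Ec : ℝ) * (r : ℝ)) * D0 / (al * Real.cos α * Real.sin D0) + 4 * m * K))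
    (hinit : E1 0 < D0 ^ 2 / 8)
    (Dinf : ℝ) (hDinf : 0 < Dinf ∧ Dinf < Real.pi / 2) (hDinfD0 : Dinf < D0)
    (hKbig : Real.sqrt K
      > ((1 + (r : ℝ) * (Ec : ℝ)) / (al * Real.cos α))
          * max (D0 / Real.sin D0) (1 / Real.cos Dinf))
    (hmK1 : m * Real.sqrt K < 1 / 8)
    (hmK2 : m * K
      < (al / (au ^ 2 * (1 + (r : ℝ) * (Ec : ℝ)) * Real.cos α))
          * min (Real.sin D0 / (36 * D0)) (Real.cos Dinf / 24))
    (hC1 : C1 < Dinf ^ 2 / 16)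
    :
    ∃ tstar ≥ (0 : ℝ), ∀ t ≥ tstar, ∀ i j, |θ i t - θ j t| ≤ Dinf := by
  have hC1lt := hC1
  clear hC1
  have hC1eq := hC1
  have hEe : ∀ i j, 0 < a i j → (i, j) ∈ (Finset.filter
      (fun p : Fin N × Fin N => 0 < a p.1 p.2) Finset.univ) := by
    intro i j h; simp [h]
  have hal_le : ∀ i j, 0 < a i j → al ≤ a i j := by
    intro i j h
    rw [hal]
    exact Finset.inf'_le (fun p : Fin N × Fin N => a p.1 p.2) (hEe i j h)
  have halpos : 0 < al := by
    rw [hal, Finset.lt_inf'_iff]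
    intro p hp
    simpa using hp
  have hau_le' : ∀ i j, 0 < a i j → a i j ≤ au := by
    intro i j h
    rw [hau]
    exact Finset.le_sup' (fun p : Fin N × Fin N => a p.1 p.2) (hEe i j h)
  have haupos : 0 < au := by
    obtain ⟨p, hp⟩ := hEne
    have : 0 < a p.1 p.2 := by simpa using hp
    exact this.trans_le (hau_le' _ _ this)
  have hau_le : ∀ i j, a i j ≤ au := by
    intro i j
    rcases (hnn i j).eq_or_lt with h | h
    · rw [← h]; exact haupos.le
    · exact hau_le' i j h
  obtain ⟨hD0p, hD0pi⟩ := hD0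
  have hcα : 0 < Real.cos α := Real.cos_pos_of_mem_Ioo ⟨by linarith [Real.pi_pos], hα.2⟩
  have hsD : 0 < Real.sin D0 := Real.sin_pos_of_pos_of_lt_pi hD0p hD0pi
  set κ := Real.sqrt K with hκdef
  have hκ : 0 < κ := Real.sqrt_pos.2 hK
  have hK2 : K = κ ^ 2 := (Real.sq_sqrt hK.le).symm
  set R : ℝ := 1 + (r : ℝ) * (Ec : ℝ) with hR
  have hRp : 0 < R := by positivity
  have hR' : 1 + (Ec : ℝ) * (r : ℝ) = R := by rw [hR]; ring
  rw [hR'] at hC1eq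
  set L : ℝ := Real.cos α * (al * (Real.sin D0 / D0) / R) with hL
  have hLp : 0 < L := by positivity
  have hκL : 1 < κ * L := by
    have h1 : R / (al * Real.cos α) * (D0 / Real.sin D0) < κ :=
      lt_of_le_of_lt (mul_le_mul_of_nonneg_left (le_max_left _ _) (by positivity)) hKbig
    have h2 := mul_lt_mul_of_pos_right h1 hLp
    have h3 : R / (al * Real.cos α) * (D0 / Real.sin D0) * L = 1 := by
      rw [hL]; field_simp
    linarith
  have hmK : m * K * (Real.cos α ^ 2 * au ^ 2) ≤ L / 36 := by
    have h1 : m * K ≤ al / (au ^ 2 * R * Real.cos α) * (Real.sin D0 / (36 * D0)) :=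
      hmK2.le.trans (mul_le_mul_of_nonneg_left (min_le_left _ _) (by positivity))
    have h2 := mul_le_mul_of_nonneg_right h1 (by positivity : 0 ≤ Real.cos α ^ 2 * au ^ 2)
    refine h2.trans (le_of_eq ?_)
    rw [hL]; field_simp
  have hDΩ' : DΩ = ∑ i, ∑ j, (Ω i - Ω j) ^ 2 := by
    rw [hDΩ]; simp only [sq_abs]
  have hC1' : κ * C1 = 3 / (K * L) * (∑ i, ∑ j, (Ω i - Ω j) ^ 2)
      + 12 * m * (∑ i, ∑ j, (Ω i - Ω j) ^ 2)
      + 12 * (N : ℝ) ^ 2 * K * au ^ 2 * Real.sin α ^ 2 * (1 / L + 4 * m * K) := by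
    rw [← hDΩ', hC1eq, hL, hK2]
    field_simp
    try ring
  -- main differential inequality
  have hdiff : ∀ t ≥ (0 : ℝ), E1 t ≤ D0 ^ 2 / 8 → deriv E1 t ≤ κ * (C1 - E1 t) := by
    intro t ht hE
    have hd : ∀ i j, |θ i t - θ j t| ≤ D0 := by
      intro i j
      have := pde_coercive m κ hmK1 (fun i => θ i t) (fun i => deriv (θ i) t) i j
      beta_reduce at this
      rw [← hE1] at this
      exact abs_le_of_sq_le_sq (by nlinarith) hD0p.le
    have hS : L * ∑ i, ∑ j, (θ i t - θ j t) ^ 2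
      ≤ Real.cos α * ∑ i, ∑ j, a i j * ((θ i t - θ j t) * Real.sin (θ i t - θ j t)) := by
      have hc := pde_conn N a G hadj hconn r hr Ec hEc (fun i => θ i t)
      rw [Fintype.sum_prod_type] at hc
      rw [hL, mul_assoc]
      refine mul_le_mul_of_nonneg_left ?_ hcα.le
      have h1 : al * (Real.sin D0 / D0) * ∑ p ∈ Finset.univ.filter
          (fun p : Fin N × Fin N => 0 < a p.1 p.2), (θ p.1 t - θ p.2 t) ^ 2
          ≤ ∑ i, ∑ j, a i j * ((θ i t - θ j t) * Real.sin (θ i t - θ j t)) := by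
        rw [← Fintype.sum_prod_type (f := fun p : Fin N × Fin N =>
          a p.1 p.2 * ((θ p.1 t - θ p.2 t) * Real.sin (θ p.1 t - θ p.2 t))), Finset.mul_sum,
          Finset.sum_filter]
        refine Finset.sum_le_sum fun p _ => ?_
        have hb := pde_sin_bound D0 _ hD0p hD0pi (hd p.1 p.2)
        have hb0 : 0 ≤ Real.sin D0 / D0 * (θ p.1 t - θ p.2 t) ^ 2 := by positivity
        split_ifs with hp
        · rw [mul_assoc]
          exact mul_le_mul (hal_le _ _ hp) hb hb0 (hnn _ _)
        · exact mul_nonneg (hnn _ _) (hb0.trans hb)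
      refine le_trans ?_ h1
      calc _ ≤ al * (Real.sin D0 / D0) / R * (R * _) :=
            mul_le_mul_of_nonneg_left hc (by positivity)
        _ = _ := by field_simp
    have h := (pde_deriv m κ θ hθ _ E1 hE1 t).2 (fun i => hODE i t ht)
    have hcore := pde_core hN a hsym hnn au hau_le m κ K L α C1 Ω (fun i => θ i t)
      (fun i => deriv (θ i) t) _ hm hκ hK2 hLp hκL hmK1 hmK hS (fun i => rfl) hC1'
    rw [h]
    linarith
  have hE1d : ∀ t, HasDerivAt E1 (deriv E1 t) t := fun t =>
    (pde_deriv m κ θ hθ (fun _ => 0) E1 hE1 t).1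
  set M : ℝ := D0 ^ 2 / 8 - Dinf ^ 2 / 16 with hM
  have hMp : 0 < M := by nlinarith [hDinf.1]
  have hB : ∀ t, HasDerivAt (fun t => Dinf ^ 2 / 16 + M * Real.exp (-κ * t))
      (M * (Real.exp (-κ * t) * (-κ))) t := by
    intro t
    have h1 : HasDerivAt (fun t : ℝ => -κ * t) (-κ) t := by
      simpa using (hasDerivAt_id t).const_mul (-κ)
    exact (h1.exp.const_mul M).const_add _
  have hbound : ∀ t ≥ (0 : ℝ), E1 t ≤ Dinf ^ 2 / 16 + M * Real.exp (-κ * t) := by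
    intro t ht
    refine image_le_of_deriv_right_lt_deriv_boundary (a := 0) (b := t) (f := E1) (f' := deriv E1)
      (fun x _ => (hE1d x).continuousAt.continuousWithinAt)
      (fun x _ => (hE1d x).hasDerivWithinAt) ?_ hB ?_ ⟨ht, le_refl t⟩
    · simp only [mul_zero, Real.exp_zero, mul_one]
      linarith
    · intro x hx hxe
      have hexp : Real.exp (-κ * x) ≤ 1 := Real.exp_le_one_iff.2 (by nlinarith [hx.1])
      have hle : E1 x ≤ D0 ^ 2 / 8 := by
        rw [hxe]
        have := mul_le_mul_of_nonneg_left hexp hMp.le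
        linarith
      have := hdiff x hx.1 hle
      rw [hxe] at this
      have h2 : κ * (C1 - Dinf ^ 2 / 16) < 0 := mul_neg_of_pos_of_neg hκ (by linarith)
      refine lt_of_le_of_lt this ?_
      linarith
  have hlim := pde_lim κ M hκ
  have hDp : 0 < Dinf ^ 2 / 16 := by have := hDinf.1; positivity
  obtain ⟨T, hT⟩ := Filter.eventually_atTop.1 (hlim.eventually (gt_mem_nhds hDp))
  refine ⟨max T 0, le_max_right _ _, fun t ht i j => ?_⟩
  have hb := hbound t (le_trans (le_max_right _ _) ht)
  have hT' := hT t (le_trans (le_max_left _ _) ht)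
  have := pde_coercive m κ hmK1 (fun i => θ i t) (fun i => deriv (θ i) t) i j
  beta_reduce at this
  rw [← hE1] at this
  exact abs_le_of_sq_le_sq (by nlinarith) hDinf.1.le
end

section
/- Let G = (V, E, A) be a symmetric connected graph on V = {1,...,N} with a_u = max_{(i,j)∈E} a_{ij}. Let K > 0, α ∈ (0, π/2), D^∞ ∈ (0, π/2), and let θ_1,...,θ_N and ω_1,...,ω_N be real numbers with max_{1≤i,j≤N}|θ_i − θ_j| ≤ D^∞. Then −(K/N) sin α · Σ_{i=1}^N Σ_{j=1}^N Σ_{l=1}^N [a_{il} sin(θ_l − θ_i)(ω_l − ω_i) − a_{jl} sin(θ_l − θ_j)(ω_l − ω_j)] · 2(ω_i − ω_j) ≤ 4 K a_u sin α sin D^∞ · Σ_{i=1}^N Σ_{j=1}^N (ω_i − ω_j)². -/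
open Finset Real

/-- estimate of the sine-frustration transport term in the frequency equation. -/
theorem sine_frustration_frequency_estimate
    (N : ℕ) (hN : 0 < N)
    (a : Fin N → Fin N → ℝ)
    (hsym : ∀ i j, a i j = a j i)
    (hnn : ∀ i j, 0 ≤ a i j)
    (G : SimpleGraph (Fin N))
    (hadj : ∀ i j, G.Adj i j ↔ i ≠ j ∧ 0 < a i j)
    (hconn : G.Connected)
    (hEne : (Finset.filter (fun p : Fin N × Fin N => 0 < a p.1 p.2) Finset.univ).Nonempty)
    (r : ℕ)
    (hr : r = Finset.univ.sup (fun p : Fin N × Fin N => G.dist p.1 p.2))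
    (Ec : ℕ)
    (hEc : Ec = (Finset.filter
      (fun p : Fin N × Fin N => ¬ 0 < a p.1 p.2) Finset.univ).card)
    (au : ℝ)
    (hau : au = (Finset.filter (fun p : Fin N × Fin N => 0 < a p.1 p.2) Finset.univ).sup' hEne (fun p => a p.1 p.2))
    (K α Dinf : ℝ) (hK : 0 < K) (hα : 0 < α ∧ α < Real.pi / 2)
    (hDinf : 0 < Dinf ∧ Dinf < Real.pi / 2)
    (θ ω : Fin N → ℝ)
    (hdiam : ∀ i j, |θ i - θ j| ≤ Dinf) :
    -((K / (N : ℝ)) * Real.sin α) *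
        ∑ i, ∑ j, ∑ l,
          (a i l * Real.sin (θ l - θ i) * (ω l - ω i)
            - a j l * Real.sin (θ l - θ j) * (ω l - ω j)) * (2 * (ω i - ω j))
      ≤ 4 * K * au * Real.sin α * Real.sin Dinf * ∑ i, ∑ j, (ω i - ω j) ^ 2 := by
  have hle : ∀ i l, a i l ≤ au := by
    intro i l
    have key : ∀ i l, 0 < a i l → a i l ≤ au := by
      intro i l h
      rw [hau]
      exact Finset.le_sup' (fun p : Fin N × Fin N => a p.1 p.2)
        (b := (i, l)) (by simp [h])
    obtain ⟨p, hp⟩ := hEne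
    have hp' : 0 < a p.1 p.2 := (Finset.mem_filter.mp hp).2
    rcases (hnn i l).lt_or_eq with h | h
    · exact key i l h
    · rw [← h]
      exact hp'.le.trans (key _ _ hp')
  have hsin : ∀ i l, |Real.sin (θ l - θ i)| ≤ Real.sin Dinf := by
    intro i l
    have h := abs_le.mp (hdiam l i)
    rw [abs_le, ← Real.sin_neg]
    constructor
    · apply Real.sin_le_sin_of_le_of_le_pi_div_two <;> linarith [h.1, h.2, hDinf.1, hDinf.2]
    · apply Real.sin_le_sin_of_le_of_le_pi_div_two <;> linarith [h.1, h.2, hDinf.1, hDinf.2]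
  obtain ⟨M, hM⟩ : ∃ M, M = au * Real.sin Dinf := ⟨_, rfl⟩
  have hs : ∀ i l, |a i l * Real.sin (θ l - θ i)| ≤ M := by
    intro i l
    rw [abs_mul, abs_of_nonneg (hnn i l), hM]
    exact mul_le_mul (hle i l) (hsin i l) (abs_nonneg _) ((hnn i l).trans (hle i l))
  have hterm : ∀ s x z : ℝ, |s| ≤ M → -(M * (x ^ 2 + z ^ 2)) ≤ 2 * (s * x * z) := by
    intro s x z h
    have h := abs_le.mp h
    nlinarith [mul_nonneg (sub_nonneg.mpr h.2) (sq_nonneg (x - z)),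
      mul_nonneg (neg_le_iff_add_nonneg.mp h.1) (sq_nonneg (x + z))]
  obtain ⟨S, hS⟩ : ∃ S, S = ∑ i, ∑ j, (ω i - ω j) ^ 2 := ⟨_, rfl⟩
  have hsum : -(4 * M * N * S) ≤ ∑ i, ∑ j, ∑ l,
          (a i l * Real.sin (θ l - θ i) * (ω l - ω i)
            - a j l * Real.sin (θ l - θ j) * (ω l - ω j)) * (2 * (ω i - ω j)) := by
    have e : -(4 * M * N * S) = ∑ i : Fin N, ∑ j : Fin N, ∑ l : Fin N,
        (-M) * ((ω i - ω l) ^ 2 + (ω j - ω l) ^ 2 + 2 * (ω i - ω j) ^ 2) := by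
      simp only [← Finset.mul_sum, Finset.sum_add_distrib, Finset.sum_const,
        Finset.card_univ, Fintype.card_fin, nsmul_eq_mul, ← hS]
      ring
    rw [e]
    refine Finset.sum_le_sum fun i _ => Finset.sum_le_sum fun j _ =>
      Finset.sum_le_sum fun l _ => ?_
    have h1 := hterm _ (ω l - ω i) (ω i - ω j) (hs i l)
    have h2 := hterm _ (ω l - ω j) (-(ω i - ω j)) (hs j l)
    nlinarith [h1, h2]
  have hN' : (0 : ℝ) < N := by exact_mod_cast hN
  have hc : 0 ≤ (K / (N : ℝ)) * Real.sin α :=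
    mul_nonneg (div_pos hK hN').le
      (Real.sin_pos_of_pos_of_lt_pi hα.1 (by linarith [hα.2, Real.pi_pos])).le
  have hfin := mul_le_mul_of_nonneg_left hsum hc
  have e2 : (K / (N : ℝ)) * Real.sin α * -(4 * M * N * S)
      = -(4 * K * au * Real.sin α * Real.sin Dinf * S) := by
    rw [hM]
    field_simp
  rw [e2] at hfin
  rw [← hS]
  linarith [hfin]
end
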